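/- Let G be the simple graph on six vertices v1,...,v6 whose edges are the path edges v1v2, v2v3, v3v4, v4v5, v5v6 together with the chords v1v3, v3v5 and v4v6 (this is the graph G^6_92 in Harary's enumeration of six-vertex graphs). Then for every integer n ≥ 4, the crossing number of the Cartesian product G □ C_n equals 3n. -/

import Mathlib

open SimpleGraph

/-- A drawing of a simple graph in the plane: vertices are mapped to distinct
points, and each edge is mapped to a simple arc (parametrised by `[0,1]`)
joining the images of its endpoints and avoiding the images of all vertices
in its interior. -/
structure Drawing {V : Type*} (G : SimpleGraph V) where
  vertexMap : V → ℝ × ℝ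
  vertexMap_injective : Function.Injective vertexMap
  arc : G.edgeSet → ℝ → ℝ × ℝ
  arc_continuousOn : ∀ e, ContinuousOn (arc e) (Set.Icc 0 1)
  arc_injOn : ∀ e, Set.InjOn (arc e) (Set.Icc 0 1)
  arc_endpoints : ∀ e : G.edgeSet, ∃ u v : V,
    (e : Sym2 V) = s(u, v) ∧ arc e 0 = vertexMap u ∧ arc e 1 = vertexMap v
  arc_avoids_vertices : ∀ e : G.edgeSet, ∀ t ∈ Set.Ioo (0 : ℝ) 1, ∀ w : V,
    arc e t ≠ vertexMap w

/-- The crossings of a drawing: an unordered pair of distinct edges together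
with a point of the plane where the two corresponding arcs intersect away
from their endpoints. -/
def Drawing.crossings {V : Type*} {G : SimpleGraph V} (D : Drawing G) :
    Set (Sym2 G.edgeSet × (ℝ × ℝ)) :=
  { x | ∃ e f : G.edgeSet, e ≠ f ∧ x.1 = s(e, f) ∧
      (∃ s ∈ Set.Ioo (0 : ℝ) 1, D.arc e s = x.2) ∧
      (∃ t ∈ Set.Ioo (0 : ℝ) 1, D.arc f t = x.2) }

/-- The crossing number of a simple graph: the minimum number of crossings
over all drawings of the graph in the plane. -/
noncomputable def crossingNumber {V : Type*} (G : SimpleGraph V) : ℕ :=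
  sInf { n : ℕ | ∃ D : Drawing G, D.crossings.Finite ∧ D.crossings.ncard = n }

/-- The graph `G⁶₉₂`: the path `v1 v2 v3 v4 v5 v6` together with the chords `v1v3`, `v3v5` and `v4v6`. -/
def G6_92 : SimpleGraph (Fin 6) :=
  SimpleGraph.fromEdgeSet {s(0, 1), s(1, 2), s(2, 3), s(3, 4), s(4, 5), s(0, 2), s(2, 4), s(3, 5)}


/-! ### Planar arcs and logarithms -/

section Topology

open Complex

theorem exists_continuous_exp_eq {X : Type*} [TopologicalSpace X] [LocallyPathConnectedSpace X]
    [SimplyConnectedSpace X] {g : X → ℂ} (hg : Continuous g) (h0 : ∀ x, g x ≠ 0) :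
    ∃ f : X → ℂ, Continuous f ∧ ∀ x, exp (f x) = g x := by
  have hU : IsSimplyConnected (Set.univ : Set X) :=
    (Homeomorph.Set.univ X).toHomotopyEquiv.simplyConnectedSpace
  obtain ⟨f, hf, hfe⟩ := exists_continuousOn_eqOn_exp_comp hU isOpen_univ hg.continuousOn
    (by rintro ⟨x, -, hx⟩; exact h0 x hx)
  exact ⟨f, continuousOn_univ.mp hf, fun x => hfe (Set.mem_univ x)⟩

theorem exp_lift_sub_eq {g f₁ f₂ : ℝ → ℂ} (h₁ : Continuous f₁) (h₂ : Continuous f₂)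
    (e₁ : ∀ t, exp (f₁ t) = g t) (e₂ : ∀ t, exp (f₂ t) = g t) (s t : ℝ) :
    f₁ s - f₂ s = f₁ t - f₂ t := by
  have key : ∀ t, ∃ k : ℤ, f₁ t = f₂ t + k * (2 * Real.pi * I) := fun t =>
    exp_eq_exp_iff_exists_int.mp ((e₁ t).trans (e₂ t).symm)
  choose k hk using key
  have hre : ∀ t, ((k t : ℤ) : ℝ) = (f₁ t - f₂ t).im / (2 * Real.pi) := by
    intro t
    rw [hk t]
    simp
  have hc : Continuous k := by
    rw [Int.isClosedEmbedding_coe_real.isEmbedding.continuous_iff]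
    have : (Int.cast ∘ k : ℝ → ℝ) = fun t => (f₁ t - f₂ t).im / (2 * Real.pi) := funext hre
    rw [this]
    fun_prop
  have := PreconnectedSpace.constant (α := ℝ) inferInstance hc (x := s) (y := t)
  rw [hk s, hk t, this]
  ring

/-- The increment of a continuous logarithm along a path is determined, modulo `2πi`,
by the endpoints, and does not depend on the logarithm chosen. -/
theorem exists_exp_lift_increment {g : ℝ → ℂ} (hg : Continuous g) (h0 : ∀ t, g t ≠ 0) {a b : ℂ}
    (ha : exp a = g 0) (hb : exp b = g 1) :
    ∃ M : ℤ, ∀ f : ℝ → ℂ, Continuous f → (∀ t, exp (f t) = g t) →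
      f 1 - f 0 = b - a + M * (2 * Real.pi * I) := by
  obtain ⟨f, hf, hfe⟩ := exists_continuous_exp_eq hg h0
  obtain ⟨k, hk⟩ := exp_eq_exp_iff_exists_int.mp ((hfe 1).trans hb.symm)
  obtain ⟨l, hl⟩ := exp_eq_exp_iff_exists_int.mp ((hfe 0).trans ha.symm)
  refine ⟨k - l, fun f' hf' hfe' => ?_⟩
  have := exp_lift_sub_eq hf' hf hfe' hfe 1 0
  push_cast
  linear_combination this + hk - hl

/-- A choice of logarithms of the differences of distinct points in which swapping the points
changes the logarithm according to the tournament `b`. -/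
theorem exists_log_differences {W : Type*} {P : W → ℂ} (hP : Function.Injective P)
    {b : W → W → ℤ} (hb : ∀ u v, u ≠ v → b u v = 0 ∧ b v u = 1 ∨ b u v = 1 ∧ b v u = 0) :
    ∃ l : W → W → ℂ, (∀ u v, l u v = l v u) ∧
      ∀ u v, u ≠ v → exp (l u v + b u v * (Real.pi * I)) = P u - P v := by
  classical
  refine ⟨fun u v => if b u v = 0 ∧ b v u = 1 then log (P u - P v) else
    if b v u = 0 ∧ b u v = 1 then log (P v - P u) else 0, fun u v => ?_, fun u v huv => ?_⟩
  · by_cases h : b u v = 0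
    · have h' : b u v ≠ 1 := by omega
      simp [h]
    · simp [h]
  · rcases hb u v huv with h | h
    · simp [h, exp_log (sub_ne_zero.mpr (hP.ne huv))]
    · simp [h, exp_add, exp_log (sub_ne_zero.mpr (hP.ne huv.symm))]

/-- The mod 2 number of crossings of two edges with distinct endpoints, expressed through the
order `β` of the vertices and the winding `m` of each edge around each vertex. -/
def crossParity {P W : Type*} (src tgt : P → W) (β : W → W → ZMod 2) (m : P → W → ZMod 2)
    (e f : P) : ZMod 2 :=
  β (src e) (src f) + β (src e) (tgt f) + β (tgt e) (src f) + β (tgt e) (tgt f) +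
    m e (src f) + m e (tgt f) + m f (src e) + m f (tgt e)

def IsTournament {W : Type*} (β : W → W → ZMod 2) : Prop :=
  ∀ u v, u ≠ v → β u v + β v u = 1

theorem exists_winding_of_arcs {P W : Type*} {p : W → ℂ} (hp : Function.Injective p)
    {γ : P → ℝ → ℂ} (hγ : ∀ e, Continuous (γ e)) (src tgt : P → W)
    (h0 : ∀ e, γ e 0 = p (src e)) (h1 : ∀ e, γ e 1 = p (tgt e))
    (hav : ∀ e w, w ≠ src e → w ≠ tgt e → ∀ t, γ e t ≠ p w)
    {β : W → W → ZMod 2} (hβ : IsTournament β) :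
    ∃ m : P → W → ZMod 2, ∀ e f, src e ≠ src f → src e ≠ tgt f → tgt e ≠ src f →
      tgt e ≠ tgt f → crossParity src tgt β m e f ≠ 0 → ∃ s t, γ e s = γ f t := by
  classical
  let b : W → W → ℤ := fun u v => (β u v).val
  have hb : ∀ u v, u ≠ v → b u v = 0 ∧ b v u = 1 ∨ b u v = 1 ∧ b v u = 0 := by
    intro u v huv
    have := hβ u v huv
    simp only [b]
    generalize β u v = x at *
    generalize β v u = y at *
    revert x y
    decide
  obtain ⟨l, hl, hle⟩ := exists_log_differences hp hb
  have key : ∀ e w, ∃ M : ℤ, w ≠ src e → w ≠ tgt e → ∀ f : ℝ → ℂ, Continuous f →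
      (∀ t, exp (f t) = γ e t - p w) →
      f 1 - f 0 = l (tgt e) w + b (tgt e) w * (Real.pi * I) -
        (l (src e) w + b (src e) w * (Real.pi * I)) + M * (2 * Real.pi * I) := by
    intro e w
    by_cases hw : w ≠ src e ∧ w ≠ tgt e
    · obtain ⟨M, hM⟩ := exists_exp_lift_increment (g := fun t => γ e t - p w)
        ((hγ e).sub continuous_const) (fun t => sub_ne_zero.mpr (hav e w hw.1 hw.2 t))
        (a := l (src e) w + b (src e) w * (Real.pi * I))
        (b := l (tgt e) w + b (tgt e) w * (Real.pi * I))
        (by rw [hle _ _ hw.1.symm, h0]) (by rw [hle _ _ hw.2.symm, h1])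
      exact ⟨M, fun _ _ => hM⟩
    · exact ⟨0, fun h h' => absurd ⟨h, h'⟩ hw⟩
  choose M hM using key
  refine ⟨fun e w => M e w, fun e f hss hst hts htt hne => ?_⟩
  by_contra! hdis
  obtain ⟨L, hL, hLe⟩ := exists_continuous_exp_eq (X := ℝ × ℝ)
    (g := fun x => γ e x.1 - γ f x.2)
    (((hγ e).comp continuous_fst).sub ((hγ f).comp continuous_snd))
    (fun x => sub_ne_zero.mpr (hdis x.1 x.2))
  have A₁ := hM e (src f) hss.symm hts.symm (fun t => L (t, 0)) (by fun_prop)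
    (fun t => by rw [hLe, h0])
  have A₂ := hM e (tgt f) hst.symm htt.symm (fun t => L (t, 1)) (by fun_prop)
    (fun t => by rw [hLe, h1])
  have A₃ := hM f (src e) hss hst (fun t => L (0, t) + Real.pi * I) (by fun_prop)
    (fun t => by rw [exp_add, hLe, h0, exp_pi_mul_I]; ring)
  have A₄ := hM f (tgt e) hts htt (fun t => L (1, t) + Real.pi * I) (by fun_prop)
    (fun t => by rw [exp_add, hLe, h1, exp_pi_mul_I]; ring)
  have hsum : ∀ u v, u ≠ v → (b u v : ℂ) + b v u = 1 := by
    intro u v huv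
    rcases hb u v huv with h | h <;> simp [h]
  have hfin : ((b (tgt e) (src f) - b (src e) (src f) - b (tgt e) (tgt f) + b (src e) (tgt f) +
      M e (src f) + M f (tgt e) - M e (tgt f) - M f (src e) : ℤ) : ℂ) * (2 * Real.pi * I) = 0 := by
    push_cast
    rw [hl (tgt f) (src e), hl (src f) (src e)] at A₃
    rw [hl (tgt f) (tgt e), hl (src f) (tgt e)] at A₄
    linear_combination A₂ + A₃ - A₁ - A₄ + (Real.pi * I) * (hsum _ _ hts - hsum _ _ hss
      - hsum _ _ htt + hsum _ _ hst)
  have hz := (mul_eq_zero.mp hfin).resolve_right two_pi_I_ne_zero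
  have hz' := congrArg (Int.cast : ℤ → ZMod 2) (Int.cast_eq_zero.mp hz)
  apply hne
  have hbβ : ∀ u v, ((b u v : ℤ) : ZMod 2) = β u v := by
    intro u v
    simp [b]
  push_cast at hz'
  simp only [hbβ] at hz'
  simp only [crossParity]
  linear_combination hz' + (β (src e) (src f) + β (tgt e) (tgt f) + M e (tgt f) + M f (src e)) *
    (CharTwo.two_eq_zero (R := ZMod 2))

end Topology

/-! ### From drawings to crossing parities -/

section Drawings

variable {V : Type*} {G : SimpleGraph V}

def Disjoint4 {P W : Type*} (src tgt : P → W) (e f : P) : Prop :=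
  src e ≠ src f ∧ src e ≠ tgt f ∧ tgt e ≠ src f ∧ tgt e ≠ tgt f

theorem Drawing.exists_crossParity (D : Drawing G) {P : Type*} (edge : P → G.edgeSet)
    (src tgt : P → V) (hedge : ∀ p, (edge p : Sym2 V) = s(src p, tgt p))
    {β : V → V → ZMod 2} (hβ : IsTournament β) :
    ∃ m : P → V → ZMod 2, ∀ p q, Disjoint4 src tgt p q → crossParity src tgt β m p q ≠ 0 →
      ∃ x, (∃ s ∈ Set.Ioo (0 : ℝ) 1, D.arc (edge p) s = x) ∧
        ∃ t ∈ Set.Ioo (0 : ℝ) 1, D.arc (edge q) t = x := by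
  choose a b hab h0 h1 using fun p => D.arc_endpoints (edge p)
  let φ := Complex.equivRealProdCLM.symm
  let γ : P → ℝ → ℂ := fun p t => φ (D.arc (edge p) (Set.projIcc 0 1 zero_le_one t))
  have hγ : ∀ p, Continuous (γ p) := by
    intro p
    refine φ.continuous.comp ?_
    exact ((D.arc_continuousOn (edge p)).domRestrict).comp continuous_projIcc
  have hcases : ∀ p, ∀ t : Set.Icc (0 : ℝ) 1, D.arc (edge p) t = D.vertexMap (a p) ∨
      D.arc (edge p) t = D.vertexMap (b p) ∨ (t : ℝ) ∈ Set.Ioo (0 : ℝ) 1 := by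
    intro p t
    rcases eq_or_lt_of_le t.2.1 with h | h
    · exact Or.inl (by rw [← h, h0])
    rcases eq_or_lt_of_le t.2.2 with h' | h'
    · exact Or.inr (Or.inl (by rw [h', h1]))
    · exact Or.inr (Or.inr ⟨h, h'⟩)
  obtain ⟨m, hm⟩ := exists_winding_of_arcs (p := fun v => φ (D.vertexMap v))
    (φ.injective.comp D.vertexMap_injective) hγ a b
    (fun p => by simp [γ, h0]) (fun p => by simp [γ, h1])
    (fun p w hwa hwb t => by
      intro h
      have h := φ.injective h
      rcases hcases p (Set.projIcc 0 1 zero_le_one t) with h' | h' | h'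
      · exact hwa (D.vertexMap_injective (h.symm.trans h'))
      · exact hwb (D.vertexMap_injective (h.symm.trans h'))
      · exact D.arc_avoids_vertices _ _ h' _ h) hβ
  have hor : ∀ p, a p = src p ∧ b p = tgt p ∨ a p = tgt p ∧ b p = src p := fun p =>
    Sym2.eq_iff.mp ((hab p).symm.trans (hedge p))
  have hpar : ∀ p q, crossParity a b β m p q = crossParity src tgt β m p q := by
    intro p q
    unfold crossParity
    rcases hor p with ⟨h, h'⟩ | ⟨h, h'⟩ <;> rcases hor q with ⟨k, k'⟩ | ⟨k, k'⟩ <;>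
      rw [h, h', k, k'] <;> ring
  refine ⟨m, fun p q hd hne => ?_⟩
  have hd' : a p ≠ a q ∧ a p ≠ b q ∧ b p ≠ a q ∧ b p ≠ b q := by
    obtain ⟨d1, d2, d3, d4⟩ := hd
    rcases hor p with ⟨h, h'⟩ | ⟨h, h'⟩ <;> rcases hor q with ⟨k, k'⟩ | ⟨k, k'⟩ <;>
      simp [h, h', k, k', d1, d2, d3, d4]
  obtain ⟨s, t, hst⟩ := hm p q hd'.1 hd'.2.1 hd'.2.2.1 hd'.2.2.2 (by rwa [hpar])
  have hst := φ.injective hst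
  have inj : ∀ {u v}, D.vertexMap u ≠ D.vertexMap v ↔ u ≠ v := D.vertexMap_injective.ne_iff
  rcases hcases p (Set.projIcc 0 1 zero_le_one s) with hs | hs | hs <;>
  rcases hcases q (Set.projIcc 0 1 zero_le_one t) with ht | ht | ht
  · exact absurd (hs.symm.trans (hst.trans ht)) (inj.mpr hd'.1)
  · exact absurd (hs.symm.trans (hst.trans ht)) (inj.mpr hd'.2.1)
  · exact absurd (hst.symm.trans hs) (D.arc_avoids_vertices _ _ ht _)
  · exact absurd (hs.symm.trans (hst.trans ht)) (inj.mpr hd'.2.2.1)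
  · exact absurd (hs.symm.trans (hst.trans ht)) (inj.mpr hd'.2.2.2)
  · exact absurd (hst.symm.trans hs) (D.arc_avoids_vertices _ _ ht _)
  · exact absurd (hst.trans ht) (D.arc_avoids_vertices _ _ hs _)
  · exact absurd (hst.trans ht) (D.arc_avoids_vertices _ _ hs _)
  · exact ⟨_, ⟨_, hs, rfl⟩, ⟨_, ht, hst.symm⟩⟩

/-- The total parity over a set of ordered pairs. -/
def crossLoad {P W : Type*} (src tgt : P → W) (β : W → W → ZMod 2) (m : P → W → ZMod 2)
    (R : Finset (P × P)) : ℕ :=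
  ∑ x ∈ R, (crossParity src tgt β m x.1 x.2).val

theorem Drawing.exists_crossLoad_le (D : Drawing G) (hfin : D.crossings.Finite) {P : Type*}
    {edge : P → G.edgeSet} (hinj : Function.Injective edge)
    {src tgt : P → V} (hedge : ∀ p, (edge p : Sym2 V) = s(src p, tgt p))
    {β : V → V → ZMod 2} (hβ : IsTournament β) :
    ∃ m : P → V → ZMod 2, ∀ R : Finset (P × P), (∀ x ∈ R, Disjoint4 src tgt x.1 x.2) →
      crossLoad src tgt β m R ≤ 2 * D.crossings.ncard := by
  classical
  obtain ⟨m, hm⟩ := D.exists_crossParity edge src tgt hedge hβ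
  refine ⟨m, fun R hR => ?_⟩
  have hval : ∀ z : ZMod 2, z.val = if z ≠ 0 then 1 else 0 := by decide
  have hload : crossLoad src tgt β m R =
      (R.filter fun x => crossParity src tgt β m x.1 x.2 ≠ 0).card := by
    simp only [crossLoad, hval, Finset.card_filter]
  rw [hload]
  set R' := R.filter fun x => crossParity src tgt β m x.1 x.2 ≠ 0
  have hx : ∀ x : P × P, ∃ y, x ∈ R' →
      (∃ s ∈ Set.Ioo (0 : ℝ) 1, D.arc (edge x.1) s = y) ∧
        ∃ t ∈ Set.Ioo (0 : ℝ) 1, D.arc (edge x.2) t = y := by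
    intro x
    by_cases h : x ∈ R'
    · obtain ⟨h1, h2⟩ := Finset.mem_filter.mp h
      obtain ⟨y, hy⟩ := hm x.1 x.2 (hR x h1) h2
      exact ⟨y, fun _ => hy⟩
    · exact ⟨0, fun h' => absurd h' h⟩
  choose y hy using hx
  let F : P × P → Sym2 G.edgeSet × (ℝ × ℝ) := fun x => (s(edge x.1, edge x.2), y x)
  have hsub : (↑(R'.image F) : Set _) ⊆ D.crossings := by
    intro z hz
    obtain ⟨x, hx, rfl⟩ := Finset.mem_image.mp (Finset.mem_coe.mp hz)
    refine ⟨edge x.1, edge x.2, fun h => ?_, rfl, hy x hx⟩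
    have := hR x (Finset.mem_filter.mp hx).1
    exact this.1 (by rw [hinj h])
  have hcard := Set.ncard_le_ncard hsub hfin
  rw [Set.ncard_coe_finset] at hcard
  refine (Finset.card_le_mul_card_image R' 2 fun z hz => ?_).trans (Nat.mul_le_mul_left 2 hcard)
  obtain ⟨x, hx, rfl⟩ := Finset.mem_image.mp hz
  refine (Finset.card_le_card (t := {x, x.swap}) fun w hw => ?_).trans Finset.card_le_two
  rw [Finset.mem_insert, Finset.mem_singleton]
  have := congrArg Prod.fst (Finset.mem_filter.mp hw).2
  rcases Sym2.eq_iff.mp this with ⟨h, h'⟩ | ⟨h, h'⟩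
  · exact Or.inl (Prod.ext (hinj h) (hinj h'))
  · exact Or.inr (Prod.ext (hinj h) (hinj h'))

end Drawings

/-! ### Algebra of crossing parities -/

section Parity

variable {P W : Type*} {src tgt : P → W} {β : W → W → ZMod 2} {m : P → W → ZMod 2}

theorem Disjoint4.symm {e f : P} (h : Disjoint4 src tgt e f) : Disjoint4 src tgt f e :=
  ⟨h.1.symm, h.2.2.1.symm, h.2.1.symm, h.2.2.2.symm⟩

theorem crossParity_comm (hβ : IsTournament β) {e f : P} (h : Disjoint4 src tgt e f) :
    crossParity src tgt β m e f = crossParity src tgt β m f e := by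
  have h1 := hβ _ _ h.1
  have h2 := hβ _ _ h.2.1
  have h3 := hβ _ _ h.2.2.1
  have h4 := hβ _ _ h.2.2.2
  unfold crossParity
  linear_combination h1 + h2 + h3 + h4 - (β (src f) (src e) + β (src f) (tgt e) +
    β (tgt f) (src e) + β (tgt f) (tgt e) - 2) * (CharTwo.two_eq_zero (R := ZMod 2))

theorem crossLoad_mono {R R' : Finset (P × P)} (h : R ⊆ R') :
    crossLoad src tgt β m R ≤ crossLoad src tgt β m R' :=
  Finset.sum_le_sum_of_subset h

theorem crossLoad_image_swap [DecidableEq P] (hβ : IsTournament β) {R : Finset (P × P)}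
    (h : ∀ x ∈ R, Disjoint4 src tgt x.1 x.2) :
    crossLoad src tgt β m (R.image Prod.swap) = crossLoad src tgt β m R := by
  unfold crossLoad
  rw [Finset.sum_image (fun x _ y _ hxy => Prod.swap_injective hxy)]
  exact Finset.sum_congr rfl fun x hx => by
    rw [Prod.fst_swap, Prod.snd_swap, crossParity_comm hβ (h x hx)]

theorem ZMod.val_finset_sum_le {ι : Type*} (s : Finset ι) (f : ι → ZMod 2) :
    (∑ i ∈ s, f i).val ≤ ∑ i ∈ s, (f i).val := by
  classical
  induction s using Finset.induction_on with
  | empty => simp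
  | insert a s ha ih =>
    rw [Finset.sum_insert ha, Finset.sum_insert ha]
    exact (ZMod.val_add_le _ _).trans (by omega)

variable {P' W' : Type*} {src' tgt' : P' → W'} (fib : P' → Finset P)

/-- Replacing each edge of one structure by a path of edges of another one. -/
theorem crossParity_pullback (σ : W' → W)
    (h : ∀ p' (F : W → ZMod 2),
      ∑ p ∈ fib p', (F (src p) + F (tgt p)) = F (σ (src' p')) + F (σ (tgt' p'))) (p' q' : P') :
    crossParity src' tgt' (fun u v => β (σ u) (σ v)) (fun p' w => ∑ p ∈ fib p', m p (σ w)) p' q' =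
      ∑ p ∈ fib p', ∑ q ∈ fib q', crossParity src tgt β m p q := by
  have hsplit : ∀ p q, crossParity src tgt β m p q =
      ((β (src p) (src q) + β (src p) (tgt q)) + (β (tgt p) (src q) + β (tgt p) (tgt q))) +
        (m p (src q) + m p (tgt q)) + (m q (src p) + m q (tgt p)) := fun p q => by
    unfold crossParity; ring
  have h1 := h p' fun w => ∑ q ∈ fib q', m q w
  have h2 := h p' fun w => β w (σ (src' q')) + β w (σ (tgt' q'))
  have h3 : ∀ p, ∑ q ∈ fib q', (m q (src p) + m q (tgt p)) =
      ∑ q ∈ fib q', m q (src p) + ∑ q ∈ fib q', m q (tgt p) := fun p => Finset.sum_add_distrib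
  have h4 : ∀ p, ∑ q ∈ fib q', crossParity src tgt β m p q =
      ((β (src p) (σ (src' q')) + β (src p) (σ (tgt' q'))) +
        (β (tgt p) (σ (src' q')) + β (tgt p) (σ (tgt' q')))) +
      (m p (σ (src' q')) + m p (σ (tgt' q'))) +
      (∑ q ∈ fib q', m q (src p) + ∑ q ∈ fib q', m q (tgt p)) := by
    intro p
    simp only [hsplit]
    rw [Finset.sum_add_distrib, Finset.sum_add_distrib, Finset.sum_add_distrib, h q' (β (src p)),
      h q' (β (tgt p)), h q' (m p), h3]
  rw [Finset.sum_congr rfl fun p _ => h4 p, Finset.sum_add_distrib, Finset.sum_add_distrib, h1, h2,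
    Finset.sum_add_distrib]
  unfold crossParity
  ring

theorem crossLoad_pullback_le (σ : W' → W)
    (h : ∀ p' (F : W → ZMod 2),
      ∑ p ∈ fib p', (F (src p) + F (tgt p)) = F (σ (src' p')) + F (σ (tgt' p')))
    (hfib : ∀ x y p, p ∈ fib x → p ∈ fib y → x = y)
    {R' : Finset (P' × P')} {R : Finset (P × P)}
    (hR : ∀ x ∈ R', ∀ p ∈ fib x.1, ∀ q ∈ fib x.2, (p, q) ∈ R) :
    crossLoad src' tgt' (fun u v => β (σ u) (σ v)) (fun p' w => ∑ p ∈ fib p', m p (σ w)) R' ≤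
      crossLoad src tgt β m R := by
  classical
  have hle : ∀ x ∈ R', (crossParity src' tgt' (fun u v => β (σ u) (σ v))
      (fun p' w => ∑ p ∈ fib p', m p (σ w)) x.1 x.2).val ≤
      ∑ y ∈ fib x.1 ×ˢ fib x.2, (crossParity src tgt β m y.1 y.2).val := by
    intro x _
    rw [crossParity_pullback fib σ h, ← Finset.sum_product']
    exact ZMod.val_finset_sum_le _ _
  refine (Finset.sum_le_sum hle).trans ?_
  rw [← Finset.sum_biUnion]
  · refine Finset.sum_le_sum_of_subset fun y hy => ?_
    obtain ⟨x, hx, hy⟩ := Finset.mem_biUnion.mp hy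
    obtain ⟨h1, h2⟩ := Finset.mem_product.mp hy
    exact hR x hx _ h1 _ h2
  · intro x _ y _ hxy
    refine Finset.disjoint_left.mpr fun z hz hz' => hxy ?_
    obtain ⟨h1, h2⟩ := Finset.mem_product.mp hz
    obtain ⟨h3, h4⟩ := Finset.mem_product.mp hz'
    exact Prod.ext (hfib _ _ _ h1 h3) (hfib _ _ _ h2 h4)

end Parity

/-! ### Parity checks -/

section Checks

/-- The binary number whose digits record the parities of multiplicities in a list. -/
def parityMask (L : List ℕ) : ℕ := L.foldr (fun k a => 2 ^ k ^^^ a) 0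

theorem sum_map_eq_zero_of_parityMask {L : List ℕ} (h : parityMask L = 0) (v : ℕ → ZMod 2) :
    (L.map v).sum = 0 := by
  obtain ⟨N, hN⟩ : ∃ N, ∀ k ∈ L, k < N := ⟨L.sum + 1, fun k hk => by
    have := List.single_le_sum (by simp) k hk; omega⟩
  have key : ∀ L' : List ℕ, (∀ k ∈ L', k < N) →
      (L'.map v).sum = ∑ k ∈ Finset.range N, if (parityMask L').testBit k then v k else 0 := by
    intro L'
    induction L' with
    | nil => simp [parityMask]
    | cons a L' ih =>
      intro hb
      have hcons : parityMask (a :: L') = 2 ^ a ^^^ parityMask L' := rfl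
      have ha : v a = ∑ k ∈ Finset.range N, if a = k then v k else 0 := by
        simp [hb a (by simp)]
      rw [List.map_cons, List.sum_cons, ih fun k hk => hb k (List.mem_cons_of_mem _ hk), hcons, ha,
        ← Finset.sum_add_distrib]
      refine Finset.sum_congr rfl fun k _ => ?_
      rw [Nat.testBit_xor, Nat.testBit_two_pow]
      by_cases hk : a = k <;> cases hP : (parityMask L').testBit k <;>
        simp [hk, CharTwo.add_self_eq_zero]
  rw [key L hN, h]
  simp

variable {P W : Type*} (src tgt : P → W)

def halfEdges (C : List (P × P)) : List (P × W) :=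
  C.flatMap fun x => [(x.1, src x.2), (x.1, tgt x.2), (x.2, src x.1), (x.2, tgt x.1)]

def endPairs (C : List (P × P)) : List (W × W) :=
  C.flatMap fun x => [(src x.1, src x.2), (src x.1, tgt x.2), (tgt x.1, src x.2),
    (tgt x.1, tgt x.2)]

/-- A list of pairs of edges over which the sum of the crossing parities is equal to `b`
for every choice of the order and of the windings. -/
def IsParityCheck (rankP : P → ℕ) (rankW : W → ℕ) (K : ℕ) (C : List (P × P)) (b : ℕ) : Prop :=
  parityMask ((halfEdges src tgt C).map fun x => rankP x.1 * K + rankW x.2) = 0 ∧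
  parityMask ((endPairs src tgt C).map fun x =>
    min (rankW x.1) (rankW x.2) * K + max (rankW x.1) (rankW x.2)) = 0 ∧
  (∀ x ∈ endPairs src tgt C, rankW x.1 ≠ rankW x.2) ∧
  (endPairs src tgt C).countP (fun x => rankW x.2 < rankW x.1) % 2 = b

instance (rankP : P → ℕ) (rankW : W → ℕ) (K : ℕ) (C : List (P × P)) (b : ℕ) :
    Decidable (IsParityCheck src tgt rankP rankW K C b) := by
  unfold IsParityCheck; infer_instance

variable {src tgt}

theorem sum_crossParity_of_isParityCheck {rankP : P → ℕ} {rankW : W → ℕ} {K : ℕ}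
    (hP : Function.Injective rankP) (hW : Function.Injective rankW) (hK : ∀ w, rankW w < K)
    {β : W → W → ZMod 2} (hβ : IsTournament β) (m : P → W → ZMod 2) {C : List (P × P)} {b : ℕ}
    (h : IsParityCheck src tgt rankP rankW K C b) :
    (C.map fun x => crossParity src tgt β m x.1 x.2).sum = b := by
  classical
  obtain ⟨h1, h2, h3, h4⟩ := h
  rcases isEmpty_or_nonempty P with hPe | hPe
  · have : C = [] := List.eq_nil_of_length_eq_zero (by
      cases C with
      | nil => rfl
      | cons x _ => exact isEmptyElim x.1)
    subst this
    rw [← h4]; simp [endPairs]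
  have : Nonempty W := hPe.map src
  have e1 : ((halfEdges src tgt C).map fun x => m x.1 x.2).sum = 0 := by
    have := sum_map_eq_zero_of_parityMask h1
      fun k => m (Function.invFun rankP (k / K)) (Function.invFun rankW (k % K))
    rw [List.map_map] at this
    rw [← this]
    congr 1
    refine List.map_congr_left fun x _ => ?_
    have hx := hK x.2
    have hd : (rankP x.1 * K + rankW x.2) / K = rankP x.1 := by
      rw [add_comm, Nat.add_mul_div_right _ _ (by omega), Nat.div_eq_of_lt hx, zero_add]
    have hm : (rankP x.1 * K + rankW x.2) % K = rankW x.2 := by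
      rw [add_comm, Nat.add_mul_mod_self_right, Nat.mod_eq_of_lt hx]
    simp [hd, hm, Function.leftInverse_invFun hP _, Function.leftInverse_invFun hW _]
  have e2 : ((endPairs src tgt C).map fun x => β x.1 x.2).sum = b := by
    have := sum_map_eq_zero_of_parityMask h2
      fun k => β (Function.invFun rankW (k / K)) (Function.invFun rankW (k % K))
    rw [List.map_map] at this
    have hb : ∀ L : List (W × W), ((L.countP (fun x => rankW x.2 < rankW x.1) : ℕ) : ZMod 2) =
        (L.map fun x => if rankW x.2 < rankW x.1 then 1 else 0).sum := by
      intro L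
      induction L with
      | nil => simp
      | cons x L ih =>
        rw [List.countP_cons, List.map_cons, List.sum_cons, Nat.cast_add, ih]
        by_cases hx : rankW x.2 < rankW x.1 <;> simp [hx, add_comm]
    have hb' : (b : ZMod 2) =
        ((endPairs src tgt C).map fun x => if rankW x.2 < rankW x.1 then 1 else 0).sum := by
      rw [← hb, ← h4, ZMod.natCast_mod]
    refine Eq.trans ?_ ((congrArg₂ (· + ·) this hb'.symm).trans (zero_add _))
    rw [← List.sum_map_add]
    congr 1
    refine List.map_congr_left fun x hx => ?_
    have hdm : ∀ a c : W, (rankW a * K + rankW c) / K = rankW a ∧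
        (rankW a * K + rankW c) % K = rankW c := by
      intro a c
      have hx := hK c
      constructor
      · rw [add_comm, Nat.add_mul_div_right _ _ (by omega), Nat.div_eq_of_lt hx, zero_add]
      · rw [add_comm, Nat.add_mul_mod_self_right, Nat.mod_eq_of_lt hx]
    have hne := h3 x hx
    rcases lt_or_gt_of_ne hne with hlt | hlt
    · simp [min_eq_left hlt.le, max_eq_right hlt.le, hdm, Function.leftInverse_invFun hW _,
        not_lt.mpr hlt.le]
    · have := hβ x.1 x.2 fun h => hne (by rw [h])
      simp only [Function.comp, min_eq_right hlt.le, max_eq_left hlt.le, hdm,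
        Function.leftInverse_invFun hW _, hlt, if_true]
      linear_combination this - β x.2 x.1 * (CharTwo.two_eq_zero (R := ZMod 2))
  refine Eq.trans ?_ ((congrArg₂ (· + ·) e2 e1).trans (add_zero _))
  clear h1 h2 h3 h4 e1 e2
  induction C with
  | nil => simp [endPairs, halfEdges]
  | cons x C ih =>
    rw [List.map_cons, List.sum_cons, ih]
    simp only [endPairs, halfEdges, List.flatMap_cons, List.map_append, List.sum_append,
      List.map_cons, List.sum_cons, List.map_nil, List.sum_nil, crossParity]
    ring

end Checks

/-! ### Prisms and the removal of levels -/

section LevelMaps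

/-- A way to view a cycle of length `n` as a subdivision of a shorter cycle: `level` is the inclusion
of the vertices and `seg` tells in which edge of the shorter cycle an edge lies. -/
structure LevelMap (n' n : ℕ) [NeZero n'] [NeZero n] where
  level : Fin n' → Fin n
  seg : Fin n → Fin n'
  seg_level : ∀ i, seg (level i) = i
  seg_succ : ∀ l i, l + 1 = level i → i = seg l + 1
  sum_seg : ∀ (F : Fin n → ZMod 2) r,
    ∑ l with seg l = r, (F l + F (l + 1)) = F (level r) + F (level (r + 1))

namespace LevelMap

variable {n'' n' n : ℕ} [NeZero n''] [NeZero n'] [NeZero n]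

def comp (f : LevelMap n' n) (g : LevelMap n'' n') : LevelMap n'' n where
  level := f.level ∘ g.level
  seg := g.seg ∘ f.seg
  seg_level i := by simp [f.seg_level, g.seg_level]
  seg_succ l i h := g.seg_succ _ _ (f.seg_succ _ _ h).symm
  sum_seg F r := by
    simp only [Function.comp_apply]
    rw [← g.sum_seg (fun l => F (f.level l)) r,
      ← Finset.sum_fiberwise_of_maps_to (s := {l | g.seg (f.seg l) = r})
        (t := {l | g.seg l = r}) (g := f.seg) (by simp)]
    refine Finset.sum_congr rfl fun j hj => ?_
    rw [← f.sum_seg F j]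
    refine Finset.sum_congr ?_ fun _ _ => rfl
    ext l
    simp only [Finset.mem_filter, Finset.mem_univ, true_and] at hj ⊢
    exact ⟨fun h => h.2, fun h => ⟨h ▸ hj, h⟩⟩

def rotate (n : ℕ) [NeZero n] (c : Fin n) : LevelMap n n where
  level r := r + c
  seg l := l - c
  seg_level i := by simp
  seg_succ l i h := by
    rw [← add_sub_cancel_right i c, ← h]; abel
  sum_seg F r := by
    rw [Finset.sum_eq_single (r + c)]
    · congr 2; abel
    · intro l hl hne
      simp only [Finset.mem_filter, Finset.mem_univ, true_and] at hl
      exact absurd (by rw [← hl, sub_add_cancel]) hne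
    · simp

def dropLast (k : ℕ) : LevelMap (k + 1) (k + 2) where
  level := Fin.castSucc
  seg l := ⟨min l k, by omega⟩
  seg_level i := Fin.ext (by simp; omega)
  seg_succ l i h := by
    have h1 := congrArg Fin.val h
    rw [Fin.val_add_one, Fin.val_castSucc] at h1
    apply Fin.ext
    rw [Fin.val_add_one]
    simp only [Fin.ext_iff, Fin.val_last] at h1 ⊢
    split_ifs at h1 ⊢ <;> omega
  sum_seg F r := by
    have h1 : ∀ l : Fin (k + 1), (⟨min (l.castSucc : ℕ) k, by omega⟩ : Fin (k + 1)) = l :=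
      fun l => Fin.ext (by simp; omega)
    have h2 : (⟨min (Fin.last (k + 1) : ℕ) k, by omega⟩ : Fin (k + 1)) = Fin.last k :=
      Fin.ext (by simp)
    rw [Finset.sum_filter, Fin.sum_univ_castSucc]
    simp only [h1, h2, Finset.sum_ite_eq', Finset.mem_univ, if_true, Fin.last_add_one]
    rcases eq_or_ne r (Fin.last k) with rfl | hr
    · have : (Fin.last k).castSucc + 1 = Fin.last (k + 1) :=
        Fin.ext (by rw [Fin.val_add_one]; simp [Fin.ext_iff])
      simp only [this, if_true, Fin.last_add_one, Fin.castSucc_zero]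
      linear_combination F (Fin.last (k + 1)) * (CharTwo.two_eq_zero (R := ZMod 2))
    · have : r.castSucc + 1 = (r + 1).castSucc := Fin.ext (by
        have hr' := Fin.val_ne_of_ne hr
        simp only [Fin.val_add_one, Fin.val_castSucc, Fin.ext_iff, Fin.val_last] at hr' ⊢
        split_ifs <;> omega)
      simp [hr.symm, this]

theorem exists_truncate (k : ℕ) : ∃ f : LevelMap 3 (k + 3),
    (∀ i, (f.level i : ℕ) = i) ∧ ∀ l, f.seg l = ⟨min l 2, by omega⟩ := by
  induction k with
  | zero =>
    refine ⟨rotate 3 0, fun i => by simp [rotate], fun l => Fin.ext ?_⟩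
    simp [rotate]; omega
  | succ k ih =>
    obtain ⟨f, hf, hf'⟩ := ih
    refine ⟨(dropLast (k + 2)).comp f, fun i => ?_, fun l => ?_⟩
    · simp [comp, dropLast, hf]
    · simp only [comp, Function.comp_apply, hf', dropLast]
      exact Fin.ext (by simp)

end LevelMap

end LevelMaps

section Prisms

open Finset

/-- An order of the vertices together with windings of edges around vertices. -/
structure CrossData (P W : Type*) where
  order : W → W → ZMod 2
  winding : P → W → ZMod 2
  isTournament : IsTournament order

variable {V E : Type*} (ends : E → V × V)

/-- Edges of the product of a graph and a cycle: copies of edges of the graph in the levels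
and edges which join a vertex to its copy in the next level. -/
abbrev PrismEdge (E V : Type*) (n : ℕ) := (E ⊕ V) × Fin n

def prismSrc {n : ℕ} : PrismEdge E V n → V × Fin n
  | (.inl e, i) => ((ends e).1, i)
  | (.inr a, i) => (a, i)

def prismTgt {n : ℕ} [NeZero n] : PrismEdge E V n → V × Fin n
  | (.inl e, i) => ((ends e).2, i)
  | (.inr a, i) => (a, i + 1)

def Far {n : ℕ} [NeZero n] (x : PrismEdge E V n × PrismEdge E V n) : Prop :=
  Disjoint4 (prismSrc ends) (prismTgt ends) x.1 x.2 ∧ ∀ a, x.1.1 = .inr a → x.2.1 ≠ .inr a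

variable {ends} in
theorem Far.swap {n : ℕ} [NeZero n] {x : PrismEdge E V n × PrismEdge E V n} (h : Far ends x) :
    Far ends x.swap :=
  ⟨h.1.symm, fun a h1 h2 => h.2 a h2 h1⟩

def CrossData.load {n : ℕ} [NeZero n] (S : CrossData (PrismEdge E V n) (V × Fin n))
    (R : Finset (PrismEdge E V n × PrismEdge E V n)) : ℕ :=
  crossLoad (prismSrc ends) (prismTgt ends) S.order S.winding R

variable {ends} in
theorem CrossData.load_image_swap [DecidableEq V] [DecidableEq E] {n : ℕ} [NeZero n]
    (S : CrossData (PrismEdge E V n) (V × Fin n))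
    {R : Finset (PrismEdge E V n × PrismEdge E V n)} (h : ∀ x ∈ R, Far ends x) :
    S.load ends (R.image Prod.swap) = S.load ends R :=
  crossLoad_image_swap S.isTournament fun x hx => (h x hx).1

variable {ends} in
theorem CrossData.load_union [DecidableEq V] [DecidableEq E] {n : ℕ} [NeZero n]
    (S : CrossData (PrismEdge E V n) (V × Fin n))
    {R R' : Finset (PrismEdge E V n × PrismEdge E V n)} (h : Disjoint R R') :
    S.load ends (R ∪ R') = S.load ends R + S.load ends R' :=
  sum_union h

variable {ends} in
theorem CrossData.load_mono {n : ℕ} [NeZero n] (S : CrossData (PrismEdge E V n) (V × Fin n))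
    {R R' : Finset (PrismEdge E V n × PrismEdge E V n)} (h : R ⊆ R') :
    S.load ends R ≤ S.load ends R' :=
  crossLoad_mono h

namespace LevelMap

variable {n' n : ℕ} [NeZero n'] [NeZero n] (f : LevelMap n' n)

def Lies (p : PrismEdge E V n) (p' : PrismEdge E V n') : Prop :=
  p.1 = p'.1 ∧ (p.1.isLeft → p.2 = f.level p'.2) ∧ (p.1.isRight → f.seg p.2 = p'.2)

variable {f} in
theorem far_of_lies {p q : PrismEdge E V n} {p' q' : PrismEdge E V n'} (hp : f.Lies p p')
    (hq : f.Lies q q') (h : Far ends (p', q')) : Far ends (p, q) := by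
  have hinj : Function.Injective f.level := Function.LeftInverse.injective f.seg_level
  obtain ⟨p, i⟩ := p
  obtain ⟨q, j⟩ := q
  obtain ⟨p', i'⟩ := p'
  obtain ⟨q', j'⟩ := q'
  obtain ⟨rfl, hp1, hp2⟩ := hp
  obtain ⟨rfl, hq1, hq2⟩ := hq
  obtain ⟨h, hc⟩ := h
  refine ⟨?_, hc⟩
  rcases p with e | a <;> rcases q with e' | a' <;>
    simp only [Sum.isLeft_inl, Sum.isRight_inl, Sum.isLeft_inr, Sum.isRight_inr,
      forall_true_left, Bool.false_eq_true, false_imp_iff] at hp1 hp2 hq1 hq2 <;>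
    simp only [Disjoint4, prismSrc, prismTgt, ne_eq, Prod.mk.injEq, not_and] at h hc ⊢
  · subst hp1 hq1
    simpa [hinj.eq_iff] using h
  · subst hp1 hq2
    obtain ⟨h1, h2, h3, h4⟩ := h
    exact ⟨fun h h' => h1 h (by rw [← h', f.seg_level]), fun h h' => h2 h (f.seg_succ _ _ h'.symm),
      fun h h' => h3 h (by rw [← h', f.seg_level]), fun h h' => h4 h (f.seg_succ _ _ h'.symm)⟩
  · subst hp2 hq1
    obtain ⟨h1, h2, h3, h4⟩ := h
    exact ⟨fun h h' => h1 h (by rw [h', f.seg_level]), fun h h' => h2 h (by rw [h', f.seg_level]),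
      fun h h' => h3 h (f.seg_succ _ _ h').symm, fun h h' => h4 h (f.seg_succ _ _ h').symm⟩
  · have : a ≠ a' := fun h => hc a rfl (by rw [h])
    simp [this]

theorem exists_pullback (S : CrossData (PrismEdge E V n) (V × Fin n)) :
    ∃ S' : CrossData (PrismEdge E V n') (V × Fin n'), ∀ R' R,
      (∀ x ∈ R', ∀ p q, f.Lies p x.1 → f.Lies q x.2 → (p, q) ∈ R) →
      S'.load ends R' ≤ S.load ends R := by
  classical
  have hinj : Function.Injective f.level := Function.LeftInverse.injective f.seg_level
  let σ : V × Fin n' → V × Fin n := fun w => (w.1, f.level w.2)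
  have hσ : Function.Injective σ := fun w w' h =>
    Prod.ext (Prod.ext_iff.mp h).1 (hinj (Prod.ext_iff.mp h).2)
  let fib : PrismEdge E V n' → Finset (PrismEdge E V n)
    | (.inl e, i) => {(.inl e, f.level i)}
    | (.inr a, i) => ({l | f.seg l = i} : Finset (Fin n)).image fun l => (.inr a, l)
  have hlies : ∀ p' p, p ∈ fib p' → f.Lies p p' := by
    rintro ⟨e | a, i⟩ p hp
    · rw [mem_singleton.mp hp]
      simp [Lies]
    · obtain ⟨l, hl, rfl⟩ := mem_image.mp hp
      simpa [Lies] using hl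
  refine ⟨⟨fun u v => S.order (σ u) (σ v), fun p' w => ∑ p ∈ fib p', S.winding p (σ w),
    fun u v h => S.isTournament _ _ (hσ.ne h)⟩, fun R' R hR => ?_⟩
  refine crossLoad_pullback_le fib σ ?_ ?_ fun x hx p hp q hq =>
    hR x hx p q (hlies _ _ hp) (hlies _ _ hq)
  · rintro ⟨e | a, i⟩ F
    · simp [fib, σ, prismSrc, prismTgt]
    · simp only [fib]
      rw [sum_image fun x _ y _ h => (Prod.ext_iff.mp h).2]
      exact f.sum_seg (fun l => F (a, l)) i
  · intro x y p hx hy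
    obtain ⟨h1, h2, h3⟩ := hlies _ _ hx
    obtain ⟨k1, k2, k3⟩ := hlies _ _ hy
    refine Prod.ext (h1.symm.trans k1) ?_
    rcases h : p.1 with e | a
    · simp only [h, Sum.isLeft_inl, forall_true_left] at h2 k2
      exact hinj (h2.symm.trans k2)
    · simp only [h, Sum.isRight_inr, forall_true_left] at h3 k3
      exact h3.symm.trans k3

end LevelMap

variable [Fintype V] [Fintype E] [DecidableEq V] [DecidableEq E] (n : ℕ) [NeZero n]

instance : DecidablePred (Far (n := n) ends) := fun _ => by
  unfold Far Disjoint4; infer_instance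

def farPairs : Finset (PrismEdge E V n × PrismEdge E V n) := {x | Far ends x}

variable {n}

/-- Pairs of an edge in the level `i` and an edge outside this level. -/
def levelPairs (i : Fin n) : Finset (PrismEdge E V n × PrismEdge E V n) :=
  {x | Far ends x ∧ (x.1.1.isLeft ∧ x.1.2 = i) ∧ ¬ (x.2.1.isLeft ∧ x.2.2 = i)}

/-- Pairs of far edges charged to the level `i`. -/
def chargedPairs (i : Fin n) : Finset (PrismEdge E V n × PrismEdge E V n) :=
  {x | Far ends x ∧ x.2.1.isRight ∧
    (x.1.1.isLeft ∧ x.1.2 = i ∨ x.1.1.isRight ∧ x.1.2 + 1 = i ∧ x.2.2 = i)}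

variable {ends}

theorem Fin.add_one_add_one_ne {k : ℕ} (i : Fin (k + 3)) : i + 1 + 1 ≠ i := by
  intro h
  have h1 : (1 + 1 : Fin (k + 3)) = 0 := by rwa [add_assoc, add_eq_left] at h
  have := congrArg Fin.val h1
  rw [Fin.val_add_eq_ite] at this
  simp at this

/-- The induction on the number of levels: a lower bound for the total load of a prism follows
from the case of three levels and from a local estimate. -/
theorem two_mul_le_load_farPairs {t : ℕ}
    (base : ∀ S : CrossData (PrismEdge E V 3) (V × Fin 3),
      2 * t * 3 ≤ S.load ends (farPairs ends 3))
    (step : ∀ S : CrossData (PrismEdge E V 3) (V × Fin 3),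
      (∀ i, S.load ends (levelPairs ends i) < t) → t ≤ S.load ends (chargedPairs ends 1))
    (k : ℕ) (S : CrossData (PrismEdge E V (k + 3)) (V × Fin (k + 3))) :
    2 * t * (k + 3) ≤ S.load ends (farPairs ends (k + 3)) := by
  induction k with
  | zero => exact base S
  | succ k ih =>
    by_cases hc : ∃ i, t ≤ S.load ends (levelPairs ends i)
    · obtain ⟨i, hi⟩ := hc
      let f := (LevelMap.rotate (k + 4) (i - Fin.last _)).comp (LevelMap.dropLast (k + 2))
      obtain ⟨S', hS'⟩ := f.exists_pullback ends S
      have hlev : ∀ r, f.level r ≠ i := by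
        intro r h
        have h : r.castSucc + (i - Fin.last _) = i := h
        rw [add_sub, sub_eq_iff_eq_add] at h
        exact Fin.castSucc_ne_last r (add_left_cancel ((add_comm i _).trans h))
      let R : Finset (PrismEdge E V (k + 4) × PrismEdge E V (k + 4)) :=
        {x | Far ends x ∧ ¬ (x.1.1.isLeft ∧ x.1.2 = i) ∧ ¬ (x.2.1.isLeft ∧ x.2.2 = i)}
      have hR := hS' (farPairs ends (k + 3)) R fun x hx p q hp hq => by
        have hx := (mem_filter.mp hx).2
        have aux : ∀ p p', f.Lies (E := E) (V := V) p p' → ¬ (p.1.isLeft ∧ p.2 = i) :=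
          fun p p' h h' => hlev _ ((h.2.1 h'.1).symm.trans h'.2)
        exact mem_filter.mpr ⟨mem_univ _, LevelMap.far_of_lies ends hp hq hx,
          aux _ _ hp, aux _ _ hq⟩
      have hd1 : Disjoint R (levelPairs ends i) := by
        refine disjoint_left.mpr fun x h h' => ?_
        exact (mem_filter.mp h).2.2.1 (mem_filter.mp h').2.2.1
      have hd2 : Disjoint (R ∪ levelPairs ends i) ((levelPairs ends i).image Prod.swap) := by
        refine disjoint_left.mpr fun x h h' => ?_
        obtain ⟨y, hy, rfl⟩ := mem_image.mp h'
        have hy := (mem_filter.mp hy).2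
        rcases mem_union.mp h with h | h
        · exact (mem_filter.mp h).2.2.2 hy.2.1
        · exact hy.2.2 (mem_filter.mp h).2.2.1
      have hsub : R ∪ levelPairs ends i ∪ (levelPairs ends i).image Prod.swap ⊆
          farPairs ends (k + 4) := by
        intro x hx
        refine mem_filter.mpr ⟨mem_univ _, ?_⟩
        rcases mem_union.mp hx with hx | hx
        · rcases mem_union.mp hx with hx | hx <;> exact (mem_filter.mp hx).2.1
        · obtain ⟨y, hy, rfl⟩ := mem_image.mp hx
          exact (mem_filter.mp hy).2.1.swap
      have := S.load_mono (ends := ends) hsub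
      rw [S.load_union hd2, S.load_union hd1,
        S.load_image_swap fun x hx => (mem_filter.mp hx).2.1] at this
      have := ih S'
      change _ ≤ S.load ends (farPairs ends (k + 4))
      linarith
    · push Not at hc
      have hloc : ∀ i, t ≤ S.load ends (chargedPairs ends i) := by
        intro i
        obtain ⟨g, hg, hg'⟩ := LevelMap.exists_truncate (k + 1)
        let f := (LevelMap.rotate (k + 4) (i - 1)).comp g
        obtain ⟨S', hS'⟩ := f.exists_pullback ends S
        have hinj : Function.Injective f.level := Function.LeftInverse.injective f.seg_level
        have hf1 : f.level 1 = i := by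
          have h : g.level 1 = 1 := Fin.ext (by rw [hg]; simp)
          simp [f, LevelMap.comp, LevelMap.rotate, h]
        have hseg : ∀ l, f.seg l = 1 → l = i := by
          intro l h
          have h : g.seg (l - (i - 1)) = 1 := h
          rw [hg', Fin.ext_iff] at h
          have h : l - (i - 1) = 1 := Fin.ext (by simp at h ⊢; omega)
          rw [sub_eq_iff_eq_add] at h
          rw [h]; abel
        have hseg' : ∀ l, f.seg l + 1 = 1 → l + 1 = i := by
          intro l h
          have h0 : f.seg l = 0 := by simpa using h
          have h : g.seg (l - (i - 1)) = 0 := h0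
          rw [hg', Fin.ext_iff] at h
          have h : l - (i - 1) = 0 := Fin.ext (by simp at h ⊢; omega)
          rw [sub_eq_iff_eq_add] at h
          rw [h]; abel
        refine (step S' fun j => ?_).trans (hS' _ _ fun x hx p q hp hq => ?_)
        · refine (hS' _ _ fun x hx p q hp hq => ?_).trans_lt (hc (f.level j))
          obtain ⟨h1, h2, h3⟩ := (mem_filter.mp hx).2
          refine mem_filter.mpr ⟨mem_univ _, LevelMap.far_of_lies ends hp hq h1, ?_, ?_⟩
          · have hl : p.1.isLeft := by rw [hp.1]; exact h2.1
            exact ⟨hl, by rw [hp.2.1 hl, h2.2]⟩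
          · rintro ⟨h4, h5⟩
            exact h3 ⟨by rw [← hq.1]; exact h4, hinj ((hq.2.1 h4).symm.trans h5)⟩
        · obtain ⟨h1, h2, h3⟩ := (mem_filter.mp hx).2
          have hr : q.1.isRight := by rw [hq.1]; exact h2
          refine mem_filter.mpr ⟨mem_univ _, LevelMap.far_of_lies ends hp hq h1, hr, ?_⟩
          rcases h3 with h3 | h3
          · have hl : p.1.isLeft := by rw [hp.1]; exact h3.1
            exact Or.inl ⟨hl, by rw [hp.2.1 hl, h3.2, hf1]⟩
          · have hl : p.1.isRight := by rw [hp.1]; exact h3.1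
            exact Or.inr ⟨hl, hseg' _ (by rw [hp.2.2 hl, h3.2.1]),
              hseg _ (by rw [hq.2.2 hr, h3.2.2])⟩
      let U : Finset (PrismEdge E V (k + 4) × PrismEdge E V (k + 4)) :=
        univ.biUnion fun i => chargedPairs ends i
      have hU : t * (k + 4) ≤ S.load ends U := by
        have : S.load ends U = ∑ i, S.load ends (chargedPairs ends i) := by
          refine sum_biUnion fun i _ j _ hij => disjoint_left.mpr fun x hx hx' => hij ?_
          obtain ⟨-, h1, h2⟩ := (mem_filter.mp hx).2
          obtain ⟨-, h3, h4⟩ := (mem_filter.mp hx').2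
          rcases h2 with h2 | h2 <;> rcases h4 with h4 | h4
          · exact h2.2.symm.trans h4.2
          · exact absurd h2.1 (by simpa using h4.1)
          · exact absurd h4.1 (by simpa using h2.1)
          · exact h2.2.1.symm.trans h4.2.1
        rw [this]
        calc t * (k + 4) = ∑ i : Fin (k + 4), t := by simp [mul_comm]
          _ ≤ _ := sum_le_sum fun i _ => hloc i
      have hUfar : ∀ x ∈ U, Far ends x := by
        intro x hx
        obtain ⟨i, -, hx⟩ := mem_biUnion.mp hx
        exact (mem_filter.mp hx).2.1
      have hd : Disjoint U (U.image Prod.swap) := by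
        refine disjoint_left.mpr fun x hx hx' => ?_
        obtain ⟨y, hy, rfl⟩ := mem_image.mp hx'
        obtain ⟨i, -, hx⟩ := mem_biUnion.mp hx
        obtain ⟨j, -, hy⟩ := mem_biUnion.mp hy
        obtain ⟨-, h1, h2⟩ := (mem_filter.mp hx).2
        obtain ⟨-, h3, h4⟩ := (mem_filter.mp hy).2
        simp only [Prod.fst_swap, Prod.snd_swap] at h1 h2
        rcases h2 with h2 | h2
        · exact absurd h2.1 (by simpa using h3)
        · rcases h4 with h4 | h4
          · exact absurd h4.1 (by simpa using h1)
          · apply Fin.add_one_add_one_ne (k := k + 1) i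
            rw [← h2.2.2, h4.2.1, ← h4.2.2, h2.2.1, h2.2.2]
      have hsub : U ∪ U.image Prod.swap ⊆ farPairs ends (k + 4) := by
        intro x hx
        refine mem_filter.mpr ⟨mem_univ _, ?_⟩
        rcases mem_union.mp hx with hx | hx
        · exact hUfar x hx
        · obtain ⟨y, hy, rfl⟩ := mem_image.mp hx
          exact (hUfar y hy).swap
      have := S.load_mono (ends := ends) hsub
      rw [S.load_union hd, S.load_image_swap hUfar] at this
      change _ ≤ S.load ends (farPairs ends (k + 4))
      linarith

end Prisms

/-! ### Prisms with three levels -/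

/-- The number whose digits in base `B` are the multiplicities of the entries of a list. -/
def countMask (B : ℕ) (L : List ℕ) : ℕ := L.foldr (fun k a => B ^ k + a) 0

theorem countMask_div_mod {B : ℕ} {L : List ℕ} (h : L.length < B) (k : ℕ) :
    countMask B L / B ^ k % B = L.count k := by
  have key : ∃ lo hi, countMask B L = lo + B ^ k * (L.count k + B * hi) ∧
      lo * B ≤ L.length * B ^ k := by
    clear h
    induction L with
    | nil => exact ⟨0, 0, by simp [countMask], by simp⟩
    | cons a L ih =>
      obtain ⟨lo, hi, h1, h2⟩ := ih
      have h3 : countMask B (a :: L) = B ^ a + countMask B L := rfl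
      rcases lt_trichotomy a k with h | rfl | h
      · refine ⟨B ^ a + lo, hi, ?_, ?_⟩
        · rw [h3, h1, List.count_cons_of_ne h.ne]; ring
        · rw [List.length_cons, add_mul, add_mul, ← pow_succ, add_comm]
          refine Nat.add_le_add h2 ?_
          rw [one_mul]
          rcases Nat.eq_zero_or_pos B with rfl | hB
          · simp
          · exact Nat.pow_le_pow_right hB h
      · refine ⟨lo, hi, ?_, ?_⟩
        · rw [h3, h1, List.count_cons_self]; ring
        · exact h2.trans (Nat.mul_le_mul_right _ (by simp))
      · refine ⟨lo, hi + B ^ (a - k - 1), ?_, ?_⟩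
        · obtain ⟨d, rfl⟩ := Nat.exists_eq_add_of_lt h
          rw [h3, h1, List.count_cons_of_ne h.ne', show k + d + 1 - k - 1 = d by omega]
          ring
        · exact h2.trans (Nat.mul_le_mul_right _ (by simp))
  obtain ⟨lo, hi, h1, h2⟩ := key
  have hB : 0 < B := by omega
  have hlo : lo < B ^ k := by
    refine Nat.lt_of_mul_lt_mul_right (a := B) (h2.trans_lt ?_)
    rw [mul_comm]
    exact Nat.mul_lt_mul_of_pos_left h (by positivity)
  rw [h1, Nat.add_mul_div_left _ _ (by positivity), Nat.div_eq_of_lt hlo, zero_add,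
    Nat.add_mul_mod_self_left, Nat.mod_eq_of_lt (List.count_le_length.trans_lt h)]

section ThreeLevels

open Finset

variable {e v : ℕ}

def prismRank : PrismEdge (Fin e) (Fin v) 3 → ℕ
  | (.inl x, i) => e * i + x
  | (.inr a, i) => 3 * e + 3 * a + i

def prismVertexRank (w : Fin v × Fin 3) : ℕ := 3 * w.1 + w.2

theorem prismVertexRank_injective : Function.Injective (prismVertexRank (v := v)) := by
  rintro ⟨a, i⟩ ⟨b, j⟩ h
  simp only [prismVertexRank] at h
  ext <;> simp only <;> omega

theorem prismVertexRank_lt (w : Fin v × Fin 3) : prismVertexRank w < 3 * v := by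
  obtain ⟨a, i⟩ := w
  simp only [prismVertexRank]
  omega

theorem prismRank_injective : Function.Injective (prismRank (e := e) (v := v)) := by
  rintro ⟨x | a, i⟩ ⟨y | b, j⟩ h
  · have : i = j ∧ x = y := by
      fin_cases i <;> fin_cases j <;> simp [prismRank, Fin.ext_iff] at h ⊢ <;> omega
    simp [this]
  · exfalso
    fin_cases i <;> simp [prismRank] at h <;> omega
  · exfalso
    fin_cases j <;> simp [prismRank] at h <;> omega
  · simp only [prismRank] at h
    ext
    · simp only [Sum.inr.injEq, Fin.ext_iff]; omega
    · simp only; omega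

variable (e v) in
/-- The edge of the rank `k`. -/
def prismEdge [NeZero e] [NeZero v] (k : ℕ) : PrismEdge (Fin e) (Fin v) 3 :=
  if k < 3 * e then (.inl (Fin.ofNat e (k % e)), Fin.ofNat 3 (k / e))
  else (.inr (Fin.ofNat v ((k - 3 * e) / 3)), Fin.ofNat 3 (k - 3 * e))

variable (ends : Fin e → Fin v × Fin v)

abbrev IsPrismCheck (C : List (PrismEdge (Fin e) (Fin v) 3 × PrismEdge (Fin e) (Fin v) 3))
    (b : ℕ) : Prop :=
  IsParityCheck (prismSrc ends) (prismTgt ends) prismRank prismVertexRank (3 * v) C b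

def CrossData.parity (S : CrossData (PrismEdge (Fin e) (Fin v) 3) (Fin v × Fin 3))
    (x : PrismEdge (Fin e) (Fin v) 3 × PrismEdge (Fin e) (Fin v) 3) : ZMod 2 :=
  crossParity (prismSrc ends) (prismTgt ends) S.order S.winding x.1 x.2

variable {ends} (S : CrossData (PrismEdge (Fin e) (Fin v) 3) (Fin v × Fin 3))

theorem CrossData.sum_parity {C b} (h : IsPrismCheck ends C b) :
    (C.map (S.parity ends)).sum = b :=
  sum_crossParity_of_isParityCheck prismRank_injective prismVertexRank_injective
    prismVertexRank_lt S.isTournament S.winding h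

theorem CrossData.exists_parity_ne_zero {C} (h : IsPrismCheck ends C 1) :
    ∃ x ∈ C, S.parity ends x ≠ 0 := by
  by_contra! hc
  have := S.sum_parity h
  rw [List.map_congr_left hc] at this
  simp at this

theorem CrossData.parity_swap {x : PrismEdge (Fin e) (Fin v) 3 × PrismEdge (Fin e) (Fin v) 3}
    (h : Far ends x) : S.parity ends x.swap = S.parity ends x :=
  (crossParity_comm S.isTournament h.1).symm

theorem CrossData.one_le_load {x : PrismEdge (Fin e) (Fin v) 3 × PrismEdge (Fin e) (Fin v) 3}
    {R : Finset (PrismEdge (Fin e) (Fin v) 3 × PrismEdge (Fin e) (Fin v) 3)}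
    (hx : x ∈ R) (h : S.parity ends x ≠ 0) : 1 ≤ S.load ends R :=
  (Nat.one_le_iff_ne_zero.mpr ((ZMod.val_eq_zero _).not.mpr h)).trans
    (single_le_sum (f := fun x => (S.parity ends x).val) (fun _ _ => Nat.zero_le _) hx)

theorem CrossData.two_le_load {x y : PrismEdge (Fin e) (Fin v) 3 × PrismEdge (Fin e) (Fin v) 3}
    {R : Finset (PrismEdge (Fin e) (Fin v) 3 × PrismEdge (Fin e) (Fin v) 3)}
    (hx : x ∈ R) (hy : y ∈ R) (hxy : x ≠ y) (h : S.parity ends x ≠ 0)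
    (h' : S.parity ends y ≠ 0) : 2 ≤ S.load ends R := by
  have hd : Disjoint {x} {y} := disjoint_singleton.mpr hxy
  have := S.load_mono (ends := ends) (R := {x} ∪ {y}) (R' := R) (by
    intro z hz; simp at hz; rcases hz with rfl | rfl <;> assumption)
  rw [S.load_union hd] at this
  have h1 := S.one_le_load (mem_singleton_self x) h
  have h2 := S.one_le_load (mem_singleton_self y) h'
  omega

/-- If the load of a family of pairs is at most one, then all parities vanish on an even check
contained in the family. -/
theorem CrossData.parity_eq_zero {C} {R : Finset (PrismEdge (Fin e) (Fin v) 3 ×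
    PrismEdge (Fin e) (Fin v) 3)} (hR : S.load ends R < 2) (hC : IsPrismCheck ends C 0)
    (hn : C.Nodup) (hCR : ∀ x ∈ C, x ∈ R) : ∀ x ∈ C, S.parity ends x = 0 := by
  intro x hx
  by_contra hne
  have hsum := S.sum_parity hC
  obtain ⟨C', hperm⟩ : ∃ C', C.Perm (x :: C') := by
    obtain ⟨s, t, rfl⟩ := List.append_of_mem hx
    exact ⟨_, List.perm_middle⟩
  have hn' := hperm.nodup_iff.mp hn
  have : ∃ y ∈ C', S.parity ends y ≠ 0 := by
    by_contra! hc
    rw [(hperm.map _).sum_eq, List.map_cons, List.sum_cons, List.map_congr_left hc] at hsum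
    simp at hsum
    exact hne hsum
  obtain ⟨y, hy, hy'⟩ := this
  have := S.two_le_load (hCR x hx) (hCR y (hperm.mem_iff.mpr (List.mem_cons_of_mem _ hy)))
    (by rintro rfl; exact (List.nodup_cons.mp hn').1 hy) hne hy'
  omega

variable [NeZero e] [NeZero v]

variable (e v) in
/-- The pair of edges of the ranks `k / (3 * (e + v))` and `k % (3 * (e + v))`. -/
def prismPair (k : ℕ) : PrismEdge (Fin e) (Fin v) 3 × PrismEdge (Fin e) (Fin v) 3 :=
  (prismEdge e v (k / (3 * (e + v))), prismEdge e v (k % (3 * (e + v))))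

variable (ends) in
/-- A family of odd checks which contains each unordered pair of edges at most `N` times.
The number `B` is a bound for the total number of pairs. -/
def IsCheckFamily (N B : ℕ) (Cs : List (List ℕ)) : Prop :=
  (∀ C ∈ Cs, IsPrismCheck ends (C.map (prismPair e v)) 1) ∧
  Cs.flatten.length < B ∧ (∀ k ∈ Cs.flatten, k < (3 * (e + v)) ^ 2) ∧
  ∀ k < (3 * (e + v)) ^ 2, countMask B Cs.flatten / B ^ k % B ≤ N ∧
    (countMask B Cs.flatten / B ^ k % B ≠ 0 → Far ends (prismPair e v k) ∧
      prismRank (prismPair e v k).1 < prismRank (prismPair e v k).2 ∧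
      prismRank (prismPair e v k).1 * (3 * (e + v)) + prismRank (prismPair e v k).2 = k)

instance (N B : ℕ) (Cs : List (List ℕ)) : Decidable (IsCheckFamily ends N B Cs) := by
  unfold IsCheckFamily; infer_instance

theorem CrossData.two_mul_length_le_load {N B : ℕ} {Cs : List (List ℕ)}
    (h : IsCheckFamily ends N B Cs) :
    2 * Cs.length ≤ N * S.load ends (farPairs ends 3) := by
  obtain ⟨hC, hB, hlt, hm⟩ := h
  classical
  let w : ℕ → ℕ := fun k => (S.parity ends (prismPair e v k)).val
  have hN : ∀ k ∈ Cs.flatten, Cs.flatten.count k ≤ N := fun k h => by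
    rw [← countMask_div_mod hB]
    exact (hm k (hlt k h)).1
  have hk : ∀ k ∈ Cs.flatten, Far ends (prismPair e v k) ∧
      prismRank (prismPair e v k).1 < prismRank (prismPair e v k).2 ∧
      prismRank (prismPair e v k).1 * (3 * (e + v)) + prismRank (prismPair e v k).2 = k :=
    fun k h => (hm k (hlt k h)).2 (by
      rw [countMask_div_mod hB]
      exact (List.count_pos_iff.mpr h).ne')
  have h1 : Cs.length ≤ (Cs.flatten.map w).sum := by
    clear hN hk hB hlt hm
    induction Cs with
    | nil => simp
    | cons C Cs ih =>
      have := ih fun C' h => hC C' (List.mem_cons_of_mem _ h)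
      obtain ⟨x, hx, hne⟩ := S.exists_parity_ne_zero (hC C List.mem_cons_self)
      obtain ⟨k, hk, rfl⟩ := List.mem_map.mp hx
      have h2 : w k ≤ (C.map w).sum := List.single_le_sum (by simp) _ (List.mem_map_of_mem hk)
      have h3 : 1 ≤ w k := Nat.one_le_iff_ne_zero.mpr ((ZMod.val_eq_zero _).not.mpr hne)
      rw [List.flatten_cons, List.map_append, List.sum_append, List.length_cons]
      omega
  have h2 : (Cs.flatten.map w).sum ≤ N * ∑ k ∈ Cs.flatten.toFinset, w k := by
    rw [Finset.sum_list_map_count, mul_sum]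
    refine sum_le_sum fun k hk' => ?_
    rw [smul_eq_mul]
    exact Nat.mul_le_mul_right _ (hN k (List.mem_toFinset.mp hk'))
  let R := Cs.flatten.toFinset.image (prismPair e v)
  have h3 : ∑ k ∈ Cs.flatten.toFinset, w k = S.load ends R := by
    refine (sum_image (f := fun x => (S.parity ends x).val) fun a ha b hb hab => ?_).symm
    have ha := (hk a (List.mem_toFinset.mp ha)).2.2
    have hb := (hk b (List.mem_toFinset.mp hb)).2.2
    rw [← ha, ← hb, hab]
  have hR : ∀ x ∈ R, Far ends x ∧ prismRank x.1 < prismRank x.2 := by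
    intro x hx
    obtain ⟨k, hk', rfl⟩ := mem_image.mp hx
    have := hk k (List.mem_toFinset.mp hk')
    exact ⟨this.1, this.2.1⟩
  have hd : Disjoint R (R.image Prod.swap) := by
    refine disjoint_left.mpr fun x hx hx' => ?_
    obtain ⟨y, hy, rfl⟩ := mem_image.mp hx'
    exact lt_asymm (hR y hy).2 (hR _ hx).2
  have h4 := S.load_mono (ends := ends) (R := R ∪ R.image Prod.swap) (R' := farPairs ends 3) (by
    intro x hx
    refine mem_filter.mpr ⟨mem_univ _, ?_⟩
    rcases mem_union.mp hx with hx | hx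
    · exact (hR x hx).1
    · obtain ⟨y, hy, rfl⟩ := mem_image.mp hx
      exact (hR y hy).1.swap)
  rw [S.load_union hd, S.load_image_swap fun x hx => (hR x hx).1] at h4
  have := Nat.mul_le_mul_left N h4
  rw [h3] at h2
  linarith

/-- The check obtained from `C` by an automorphism of the base graph, given by lists of images of
edges and of vertices, and by a permutation of levels. -/
def permuteCheck (e v : ℕ) (es vs ls : List ℕ) (C : List (ℕ × ℕ)) : List ℕ :=
  let f : ℕ → ℕ := fun k =>
    if k < 3 * e then e * ls.getD (k / e) 0 + es.getD (k % e) 0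
    else 3 * e + 3 * vs.getD ((k - 3 * e) / 3) 0 + (ls.getD ((k - 3 * e + 2) % 3) 0 + 1) % 3
  C.map fun x => min (f x.1) (f x.2) * (3 * (e + v)) + max (f x.1) (f x.2)

end ThreeLevels


section LocalChecks

variable (e v : ℕ) [NeZero e] [NeZero v]

/-- All pairs of edges from two lists of ranks. -/
def rankPairs (L L' : List ℕ) : List (PrismEdge (Fin e) (Fin v) 3 × PrismEdge (Fin e) (Fin v) 3) :=
  (L.map (prismEdge e v)) ×ˢ (L'.map (prismEdge e v))

/-- The pairs of edges which belong to independent edges of a subdivided complete graph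
with five vertices: `cᵢ` joins the two branch vertices of the middle level other than the `i`th one,
while `pᵢ` and `qᵢ` join the `i`th one to the two remaining branch vertices, joined by `r`. -/
def k5Pairs (c₁ c₂ c₃ p₁ p₂ p₃ q₁ q₂ q₃ r : List ℕ) :
    List (PrismEdge (Fin e) (Fin v) 3 × PrismEdge (Fin e) (Fin v) 3) :=
  rankPairs e v c₁ (p₁ ++ q₁ ++ r) ++ rankPairs e v c₂ (p₂ ++ q₂ ++ r) ++
    rankPairs e v c₃ (p₃ ++ q₃ ++ r) ++ rankPairs e v q₁ (p₂ ++ p₃) ++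
    rankPairs e v q₂ (p₁ ++ p₃) ++ rankPairs e v q₃ (p₁ ++ p₂)

end LocalChecks

section Triangle

def triangleEnds : Fin 3 → Fin 3 × Fin 3 := ![(0, 1), (1, 2), (0, 2)]

def triangleSymmetries : List (List ℕ × List ℕ) :=
  [([0, 1, 2], [0, 1, 2]), ([0, 2, 1], [1, 0, 2]), ([2, 1, 0], [0, 2, 1]), ([1, 0, 2], [2, 1, 0]),
    ([1, 2, 0], [1, 2, 0]), ([2, 0, 1], [2, 0, 1])]

def threePerms : List (List ℕ) :=
  [[0, 1, 2], [1, 0, 2], [0, 2, 1], [2, 1, 0], [1, 2, 0], [2, 0, 1]]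

def triangleChecks : List (List ℕ) :=
  triangleSymmetries.flatMap fun g => threePerms.map fun ls => permuteCheck 3 3 g.1 g.2 ls
    [(1, 5), (1, 8), (1, 9), (1, 11), (1, 16), (2, 3), (2, 5), (2, 7), (2, 13), (2, 16), (3, 8),
      (3, 11), (3, 15), (3, 16), (5, 7), (5, 8), (5, 11), (5, 12), (5, 13), (7, 9), (7, 15),
      (8, 12), (8, 15), (9, 12), (9, 13), (9, 15), (9, 16), (11, 12), (11, 15), (12, 16), (13, 15)]

theorem triangleChecks_isCheckFamily : IsCheckFamily triangleEnds 12 2048 triangleChecks := by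
  decide +kernel

theorem six_le_load_triangle (S : CrossData (PrismEdge (Fin 3) (Fin 3) 3) (Fin 3 × Fin 3)) :
    2 * 1 * 3 ≤ S.load triangleEnds (farPairs triangleEnds 3) := by
  have h := S.two_mul_length_le_load triangleChecks_isCheckFamily
  simp only [triangleChecks, triangleSymmetries, threePerms, List.length_flatMap, List.map_cons,
    List.map_nil, List.length_cons, List.length_nil, List.sum_cons, List.sum_nil] at h
  omega

theorem one_le_load_chargedPairs_triangle
    (S : CrossData (PrismEdge (Fin 3) (Fin 3) 3) (Fin 3 × Fin 3))
    (h : ∀ i, S.load triangleEnds (levelPairs triangleEnds i) < 1) :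
    1 ≤ S.load triangleEnds (chargedPairs triangleEnds 1) := by
  have hC : IsPrismCheck triangleEnds
      (k5Pairs 3 3 [4] [5] [3] [10] [13, 6] [16, 8] [9] [12, 0] [15, 2] [11]) 1 ∧
      ∀ x ∈ k5Pairs 3 3 [4] [5] [3] [10] [13, 6] [16, 8] [9] [12, 0] [15, 2] [11],
        x ∈ chargedPairs triangleEnds 1 ∨ (∃ i, x ∈ levelPairs triangleEnds i) ∨
          ∃ i, x.swap ∈ levelPairs triangleEnds i := by
    simp only [chargedPairs, levelPairs, Finset.mem_filter, Finset.mem_univ, true_and]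
    decide +kernel
  obtain ⟨x, hx, hne⟩ := S.exists_parity_ne_zero hC.1
  rcases hC.2 x hx with hx | ⟨i, hx⟩ | ⟨i, hx⟩
  · exact S.one_le_load hx hne
  · exact absurd (S.one_le_load hx hne) (not_le.mpr (h i))
  · have hs := S.parity_swap (Finset.mem_filter.mp hx).2.1
    rw [Prod.swap_swap] at hs
    rw [hs] at hne
    exact absurd (S.one_le_load hx hne) (not_le.mpr (h i))

end Triangle

section Diamond

def diamondEnds : Fin 5 → Fin 4 × Fin 4 := ![(0, 1), (0, 2), (1, 2), (1, 3), (2, 3)]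

def diamondSymmetries : List (List ℕ × List ℕ) :=
  [([0, 1, 2, 3, 4], [0, 1, 2, 3]), ([1, 0, 2, 4, 3], [0, 2, 1, 3]),
    ([3, 4, 2, 0, 1], [3, 1, 2, 0]), ([4, 3, 2, 1, 0], [3, 2, 1, 0])]

def diamondChecks : List (List ℕ) :=
  diamondSymmetries.flatMap fun g => threePerms.flatMap fun ls =>
    [permuteCheck 5 4 g.1 g.2 ls
      [(0, 7), (0, 10), (0, 11), (0, 19), (0, 22), (2, 5), (2, 10), (2, 16), (2, 19), (5, 10),
        (5, 11), (5, 20), (5, 23), (7, 10), (7, 15), (7, 16), (7, 20), (10, 15), (10, 22), (10,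
        23), (11, 15), (11, 19), (11, 20), (15, 19), (15, 22), (16, 19), (16, 20), (16, 22),
        (16, 23), (19, 23), (20, 22)],
    permuteCheck 5 4 g.1 g.2 ls
      [(0, 7), (0, 13), (0, 14), (0, 19), (0, 22), (3, 7), (3, 13), (3, 14), (3, 19), (3, 22),
        (7, 11), (7, 14), (7, 17), (7, 24), (7, 25), (9, 10), (9, 11), (9, 13), (9, 14), (10,
        14), (10, 22), (10, 25), (11, 13), (11, 19), (11, 25), (13, 17), (13, 22), (13, 24),
        (14, 17), (14, 19), (14, 24), (17, 19), (17, 22), (19, 24), (19, 25), (22, 24), (22,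
        25)]]

theorem diamondChecks_isCheckFamily : IsCheckFamily diamondEnds 8 2048 diamondChecks := by
  decide +kernel

theorem twelve_le_load_diamond (S : CrossData (PrismEdge (Fin 5) (Fin 4) 3) (Fin 4 × Fin 3)) :
    2 * 2 * 3 ≤ S.load diamondEnds (farPairs diamondEnds 3) := by
  have h := S.two_mul_length_le_load diamondChecks_isCheckFamily
  simp only [diamondChecks, diamondSymmetries, threePerms, List.length_flatMap, List.map_cons,
    List.map_nil, List.length_cons, List.length_nil, List.sum_cons, List.sum_nil] at h
  omega

/-- Products of a cycle in a level and of a cycle outside this level. -/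
def diamondCyclePairs :
    List (Fin 3 × List (PrismEdge (Fin 5) (Fin 4) 3 × PrismEdge (Fin 5) (Fin 4) 3)) :=
  [(0, rankPairs 5 4 [0, 3, 4, 1] [5, 8, 10, 13, 16, 25]),
    (2, rankPairs 5 4 [10, 13, 14, 11] [3, 5, 6, 9, 18, 24]),
    (0, rankPairs 5 4 [0, 3, 4, 1] [8, 9, 10, 11, 19, 22]),
    (2, rankPairs 5 4 [10, 13, 14, 11] [1, 5, 8, 9, 15, 21]),
    (0, rankPairs 5 4 [0, 2, 1] [5, 6, 7])]

def diamondZeros : List (PrismEdge (Fin 5) (Fin 4) 3 × PrismEdge (Fin 5) (Fin 4) 3) :=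
  diamondCyclePairs.flatMap Prod.snd

theorem diamondCyclePairs_isPrismCheck : ∀ c ∈ diamondCyclePairs,
    IsPrismCheck diamondEnds c.2 0 ∧ c.2.Nodup ∧ ∀ x ∈ c.2, x ∈ levelPairs diamondEnds c.1 := by
  simp only [levelPairs, Finset.mem_filter, Finset.mem_univ, true_and]
  decide +kernel

def diamondK5 : Fin 3 → List (PrismEdge (Fin 5) (Fin 4) 3 × PrismEdge (Fin 5) (Fin 4) 3) :=
  ![k5Pairs 5 4 [7] [6] [5] [16] [19, 10] [22, 11] [15] [18, 0] [21, 1] [17],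
    k5Pairs 5 4 [9] [8] [7] [19, 13] [22, 14] [25] [18, 3] [21, 4] [24] [26],
    k5Pairs 5 4 [8] [6, 9] [5] [16, 10] [19] [25, 13] [15, 0] [18] [24, 3] [20]]

theorem diamondK5_isPrismCheck (j : Fin 3) : IsPrismCheck diamondEnds (diamondK5 j) 1 := by
  revert j
  decide +kernel

theorem diamondK5_charged (j : Fin 3) : ∀ x ∈ diamondK5 j, x ∈ chargedPairs diamondEnds 1 ∨
    ∃ y ∈ diamondZeros, y = x ∨ y = x.swap := by
  simp only [chargedPairs, Finset.mem_filter, Finset.mem_univ, true_and]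
  revert j
  decide +kernel

theorem diamondK5_inter : ∀ x ∈ diamondK5 0, (∃ y ∈ diamondK5 1, y = x) →
    (∃ y ∈ diamondK5 2, y = x) → ∃ y ∈ diamondZeros, y = x ∨ y = x.swap := by
  decide +kernel

theorem two_le_load_chargedPairs_diamond
    (S : CrossData (PrismEdge (Fin 5) (Fin 4) 3) (Fin 4 × Fin 3))
    (h : ∀ i, S.load diamondEnds (levelPairs diamondEnds i) < 2) :
    2 ≤ S.load diamondEnds (chargedPairs diamondEnds 1) := by
  have hz : ∀ x, (∃ y ∈ diamondZeros, y = x ∨ y = x.swap) →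
      S.parity diamondEnds x = 0 := by
    have aux : ∀ x ∈ diamondZeros, Far diamondEnds x ∧ S.parity diamondEnds x = 0 := by
      intro x hx
      obtain ⟨c, hc, hx⟩ := List.mem_flatMap.mp hx
      obtain ⟨hc1, hc2, hc3⟩ := diamondCyclePairs_isPrismCheck c hc
      exact ⟨(Finset.mem_filter.mp (hc3 _ hx)).2.1, S.parity_eq_zero (h c.1) hc1 hc2 hc3 x hx⟩
    rintro x ⟨y, hy, rfl | rfl⟩
    · exact (aux y hy).2
    · have hs := S.parity_swap (aux _ hy).1
      rw [Prod.swap_swap] at hs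
      exact hs.trans (aux _ hy).2
  choose x hx hne using fun j => S.exists_parity_ne_zero (diamondK5_isPrismCheck j)
  have hT : ∀ j, x j ∈ chargedPairs diamondEnds 1 := fun j =>
    (diamondK5_charged j _ (hx j)).resolve_right fun hc => hne j (hz _ hc)
  by_contra hlt
  have heq : ∀ j, x j = x 0 := fun j => by
    by_contra hj
    exact hlt (S.two_le_load (hT j) (hT 0) hj (hne j) (hne 0))
  exact hne 0 (hz _ (diamondK5_inter _ (hx 0) ⟨_, hx 1, heq 1⟩ ⟨_, hx 2, heq 2⟩))

end Diamond

/-! ### Edges of the product of `G⁶₉₂` and a cycle -/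

section Edges

variable {k : ℕ}

def g692Ends : Fin 8 → Fin 6 × Fin 6 :=
  ![(0, 1), (1, 2), (2, 3), (3, 4), (4, 5), (0, 2), (2, 4), (3, 5)]

theorem g692_adj_iff :
    ∀ a b : Fin 6, G6_92.Adj a b ↔ ∃ x, s((g692Ends x).1, (g692Ends x).2) = s(a, b) := by
  intro a b
  simp only [G6_92, SimpleGraph.fromEdgeSet_adj, Set.mem_insert_iff, Set.mem_singleton_iff]
  revert a b
  decide

theorem cycleGraph_adj_iff (i j : Fin (k + 3)) :
    (SimpleGraph.cycleGraph (k + 3)).Adj i j ↔ j = i + 1 ∨ i = j + 1 := by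
  rw [SimpleGraph.cycleGraph_adj, sub_eq_iff_eq_add', sub_eq_iff_eq_add', or_comm]

/-- The edge of the product of `G⁶₉₂` and a cycle which corresponds to an edge of a prism. -/
def g692Edge (p : PrismEdge (Fin 8) (Fin 6) (k + 3)) :
    (G6_92 □ SimpleGraph.cycleGraph (k + 3)).edgeSet :=
  ⟨s(prismSrc g692Ends p, prismTgt g692Ends p), by
    rw [SimpleGraph.mem_edgeSet, SimpleGraph.boxProd_adj]
    rcases p with ⟨x | a, i⟩
    · exact Or.inl ⟨(g692_adj_iff _ _).mpr ⟨x, rfl⟩, rfl⟩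
    · exact Or.inr ⟨(cycleGraph_adj_iff _ _).mpr (Or.inl rfl), rfl⟩⟩

theorem g692Edge_coe (p : PrismEdge (Fin 8) (Fin 6) (k + 3)) :
    (g692Edge p : Sym2 (Fin 6 × Fin (k + 3))) = s(prismSrc g692Ends p, prismTgt g692Ends p) :=
  rfl

theorem g692Edge_surjective : Function.Surjective (g692Edge (k := k)) := by
  rintro ⟨e, he⟩
  induction e using Sym2.inductionOn with
  | hf u w =>
    obtain ⟨a, i⟩ := u
    obtain ⟨b, j⟩ := w
    rw [SimpleGraph.mem_edgeSet, SimpleGraph.boxProd_adj] at he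
    rcases he with ⟨h, hij⟩ | ⟨h, hab⟩
    · obtain rfl : i = j := hij
      obtain ⟨x, hx⟩ := (g692_adj_iff _ _).mp h
      refine ⟨(.inl x, i), Subtype.ext ?_⟩
      rw [g692Edge_coe]
      have := congrArg (Sym2.map fun a => (a, i)) hx
      simpa [prismSrc, prismTgt] using this
    · obtain rfl : a = b := hab
      rcases (cycleGraph_adj_iff _ _).mp h with h | h
      · obtain rfl : j = i + 1 := h
        exact ⟨(.inr a, i), rfl⟩
      · obtain rfl : i = j + 1 := h
        exact ⟨(.inr a, j), Subtype.ext Sym2.eq_swap⟩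

theorem g692Edge_injective : Function.Injective (g692Edge (k := k)) := by
  have hends : ∀ x y, s((g692Ends x).1, (g692Ends x).2) = s((g692Ends y).1, (g692Ends y).2) →
      x = y := by decide
  have hne : ∀ x, (g692Ends x).1 ≠ (g692Ends x).2 := by decide
  have h1 : ∀ x i a j, g692Edge (k := k) (.inl x, i) ≠ g692Edge (.inr a, j) := by
    intro x i a j h
    have h := congrArg (Sym2.map Prod.fst) (Subtype.ext_iff.mp h)
    simp only [g692Edge_coe, prismSrc, prismTgt, Sym2.map_mk] at h
    have := hne x
    rw [Sym2.eq_iff] at h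
    grind
  rintro ⟨x | a, i⟩ ⟨y | b, j⟩ h
  · have h := Subtype.ext_iff.mp h
    simp only [g692Edge_coe, prismSrc, prismTgt] at h
    obtain rfl := hends x y (by simpa only [Sym2.map_mk] using congrArg (Sym2.map Prod.fst) h)
    have := congrArg (Sym2.map Prod.snd) h
    simp only [Sym2.map_mk, Sym2.eq_iff, and_self, or_self] at this
    rw [this]
  · exact absurd h (h1 _ _ _ _)
  · exact absurd h.symm (h1 _ _ _ _)
  · have h := Subtype.ext_iff.mp h
    simp only [g692Edge_coe, prismSrc, prismTgt, Sym2.eq_iff, Prod.mk.injEq] at h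
    rcases h with ⟨⟨rfl, rfl⟩, -⟩ | ⟨⟨-, h3⟩, -, h4⟩
    · rfl
    · rw [h3] at h4
      exact absurd h4 (Fin.add_one_add_one_ne j)

end Edges

/-! ### The lower bound -/

section LowerBound

open Finset

variable {V E V' E' : Type*} {n : ℕ} [NeZero n]

def PrismEdge.map (f : E' → E) (g : V' → V) (p : PrismEdge E' V' n) : PrismEdge E V n :=
  (Sum.map f g p.1, p.2)

theorem CrossData.exists_restrict [DecidableEq V] [DecidableEq E]
    {ends : E → V × V} {ends' : E' → V' × V'} {f : E' → E} {g : V' → V}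
    (hf : Function.Injective f) (hg : Function.Injective g)
    (h : ∀ x, ends (f x) = Prod.map g g (ends' x)) (S : CrossData (PrismEdge E V n) (V × Fin n)) :
    ∃ S' : CrossData (PrismEdge E' V' n) (V' × Fin n), ∀ R, S'.load ends' R ≤
      S.load ends (R.image (Prod.map (PrismEdge.map f g) (PrismEdge.map f g))) := by
  let σ : V' × Fin n → V × Fin n := fun w => (g w.1, w.2)
  have hσ : Function.Injective σ := fun w w' h =>
    Prod.ext (hg (Prod.ext_iff.mp h).1) (Prod.ext_iff.mp h).2
  refine ⟨⟨fun u v => S.order (σ u) (σ v),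
    fun p' w => ∑ p ∈ {PrismEdge.map f g p'}, S.winding p (σ w),
    fun u v h => S.isTournament _ _ (hσ.ne h)⟩, fun R => ?_⟩
  refine crossLoad_pullback_le (fun p => {PrismEdge.map f g p}) σ ?_ ?_ ?_
  · rintro ⟨x | a, i⟩ F
    · simp [PrismEdge.map, σ, prismSrc, prismTgt, h]
    · simp [PrismEdge.map, σ, prismSrc, prismTgt]
  · intro x y p hx hy
    rw [mem_singleton] at hx hy
    have := hx.symm.trans hy
    exact Prod.ext (Sum.map_injective.mpr ⟨hf, hg⟩ (Prod.ext_iff.mp this).1)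
      (Prod.ext_iff.mp this).2
  · intro x hx p hp q hq
    rw [mem_singleton] at hp hq
    exact mem_image.mpr ⟨x, hx, by rw [hp, hq]; rfl⟩

theorem far_map {ends : E → V × V} {ends' : E' → V' × V'} {f : E' → E} {g : V' → V}
    (hg : Function.Injective g) (h : ∀ x, ends (f x) = Prod.map g g (ends' x))
    {x : PrismEdge E' V' n × PrismEdge E' V' n} (hx : Far ends' x) :
    Far ends (PrismEdge.map f g x.1, PrismEdge.map f g x.2) := by
  obtain ⟨⟨p, i⟩, ⟨q, j⟩⟩ := x
  obtain ⟨h1, h2⟩ := hx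
  constructor
  · rcases p with x | a <;> rcases q with y | b <;>
      simpa [Disjoint4, prismSrc, prismTgt, PrismEdge.map, h, hg.eq_iff] using h1
  · rcases p with x | a <;> rcases q with y | b
    · simp [PrismEdge.map]
    · simp [PrismEdge.map]
    · simp [PrismEdge.map]
    · simpa [PrismEdge.map, hg.eq_iff] using h2

theorem three_mul_le_ncard_crossings {k : ℕ}
    (D : Drawing (G6_92 □ SimpleGraph.cycleGraph (k + 3))) (hD : D.crossings.Finite) :
    3 * (k + 3) ≤ D.crossings.ncard := by
  classical
  let β : Fin 6 × Fin (k + 3) → Fin 6 × Fin (k + 3) → ZMod 2 :=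
    fun u v => if toLex u < toLex v then 1 else 0
  have hβ : IsTournament β := by
    intro u v h
    rcases lt_or_gt_of_ne (toLex.injective.ne h) with h | h <;> simp [β, h, not_lt.mpr h.le]
  obtain ⟨m, hm⟩ := D.exists_crossLoad_le hD g692Edge_injective g692Edge_coe hβ
  let S : CrossData (PrismEdge (Fin 8) (Fin 6) (k + 3)) (Fin 6 × Fin (k + 3)) := ⟨β, m, hβ⟩
  let f₁ : Fin 3 → Fin 8 := ![0, 1, 5]
  let g₁ : Fin 3 → Fin 6 := ![0, 1, 2]
  let f₂ : Fin 5 → Fin 8 := ![2, 6, 3, 7, 4]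
  let g₂ : Fin 4 → Fin 6 := ![2, 3, 4, 5]
  have hf₁ : Function.Injective f₁ := by decide
  have hg₁ : Function.Injective g₁ := by decide
  have hf₂ : Function.Injective f₂ := by decide
  have hg₂ : Function.Injective g₂ := by decide
  have h₁ : ∀ x, g692Ends (f₁ x) = Prod.map g₁ g₁ (triangleEnds x) := by decide
  have h₂ : ∀ x, g692Ends (f₂ x) = Prod.map g₂ g₂ (diamondEnds x) := by decide
  obtain ⟨S₁, hS₁⟩ := S.exists_restrict hf₁ hg₁ h₁
  obtain ⟨S₂, hS₂⟩ := S.exists_restrict hf₂ hg₂ h₂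
  have l₁ := two_mul_le_load_farPairs six_le_load_triangle
    one_le_load_chargedPairs_triangle k S₁
  have l₂ := two_mul_le_load_farPairs twelve_le_load_diamond
    two_le_load_chargedPairs_diamond k S₂
  replace hS₁ := hS₁ (farPairs triangleEnds (k + 3))
  replace hS₂ := hS₂ (farPairs diamondEnds (k + 3))
  set R₁ :=
    (farPairs triangleEnds (k + 3)).image (Prod.map (PrismEdge.map f₁ g₁) (PrismEdge.map f₁ g₁))
  set R₂ :=
    (farPairs diamondEnds (k + 3)).image (Prod.map (PrismEdge.map f₂ g₂) (PrismEdge.map f₂ g₂))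
  have hR₁ : ∀ x ∈ R₁, Far g692Ends x := by
    intro x hx
    obtain ⟨y, hy, rfl⟩ := mem_image.mp hx
    exact far_map hg₁ h₁ (mem_filter.mp hy).2
  have hR₂ : ∀ x ∈ R₂, Far g692Ends x := by
    intro x hx
    obtain ⟨y, hy, rfl⟩ := mem_image.mp hx
    exact far_map hg₂ h₂ (mem_filter.mp hy).2
  have hd : Disjoint R₁ R₂ := by
    have common : ∀ (p : PrismEdge (Fin 3) (Fin 3) (k + 3)) (q : PrismEdge (Fin 5) (Fin 4) (k + 3)),
        PrismEdge.map f₁ g₁ p = PrismEdge.map f₂ g₂ q → (PrismEdge.map f₁ g₁ p).1 = .inr 2 := by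
      rintro ⟨p, i⟩ ⟨q, j⟩ h
      replace h := (Prod.ext_iff.mp h).1
      simp only [PrismEdge.map] at h ⊢
      revert p q
      decide
    refine disjoint_left.mpr fun x hx hx' => ?_
    have hfar := hR₁ x hx
    obtain ⟨y, -, rfl⟩ := mem_image.mp hx
    obtain ⟨z, -, hz⟩ := mem_image.mp hx'
    have hz := Prod.ext_iff.mp hz
    exact hfar.2 2 (common y.1 z.1 hz.1.symm) (common y.2 z.2 hz.2.symm)
  have := hm (R₁ ∪ R₂) fun x hx => ((mem_union.mp hx).elim (hR₁ x) (hR₂ x)).1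
  have hU : S.load g692Ends (R₁ ∪ R₂) ≤ 2 * D.crossings.ncard := this
  rw [S.load_union hd] at hU
  omega

end LowerBound

/-! ### The drawing -/

section UpperBound

open Real Set

/-- The map which rolls up the plane to the punctured plane, with the period `c` in the first
coordinate. -/
noncomputable def rollUp (c : ℝ) (x : ℝ × ℝ) : ℝ × ℝ :=
  (exp x.2 * cos (2 * π * x.1 / c), exp x.2 * sin (2 * π * x.1 / c))

theorem rollUp_eq_iff {c : ℝ} (hc : c ≠ 0) {x y : ℝ × ℝ} :
    rollUp c x = rollUp c y ↔ x.2 = y.2 ∧ ∃ z : ℤ, x.1 = y.1 + z * c := by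
  constructor
  · intro h
    obtain ⟨h1, h2⟩ := Prod.ext_iff.mp h
    simp only [rollUp] at h1 h2
    have hexp : exp x.2 = exp y.2 := by
      refine (sq_eq_sq₀ (exp_pos _).le (exp_pos _).le).mp ?_
      have e1 := sin_sq_add_cos_sq (2 * π * x.1 / c)
      have e2 := sin_sq_add_cos_sq (2 * π * y.1 / c)
      have e3 := congrArg (· ^ 2) h1
      have e4 := congrArg (· ^ 2) h2
      beta_reduce at e3 e4
      linear_combination e3 + e4 - exp x.2 ^ 2 * e1 + exp y.2 ^ 2 * e2
    rw [hexp] at h1 h2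
    refine ⟨exp_injective hexp, ?_⟩
    have hang := Real.Angle.cos_sin_inj (mul_left_cancel₀ (exp_pos _).ne' h1)
      (mul_left_cancel₀ (exp_pos _).ne' h2)
    obtain ⟨z, hz⟩ := Real.Angle.angle_eq_iff_two_pi_dvd_sub.mp hang
    refine ⟨z, ?_⟩
    field_simp at hz
    linarith
  · rintro ⟨h1, z, h2⟩
    have : 2 * π * x.1 / c = 2 * π * y.1 / c + z * (2 * π) := by
      rw [h2]; field_simp
    simp only [rollUp, h1, this, cos_add_int_mul_two_pi, sin_add_int_mul_two_pi]

variable {k : ℕ}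

theorem eq_of_add_eq_add_mul {i j : Fin (k + 3)} {x y : ℝ} {z : ℤ} (h : |x - y| < 1)
    (hz : (i : ℝ) + x = j + y + z * (k + 3 : ℕ)) : i = j ∧ x = y := by
  have h1 : x - y = ((j - i + z * (k + 3 : ℕ) : ℤ) : ℝ) := by push_cast at hz ⊢; linarith
  rw [h1, ← Int.cast_abs, ← Int.cast_one, Int.cast_lt, Int.abs_lt_one_iff] at h
  have h2 : x = y := by rw [h] at h1; simpa [sub_eq_zero] using h1
  refine ⟨?_, h2⟩
  have hi := i.isLt
  have hj := j.isLt
  have hz0 : z = 0 := by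
    rw [← Int.abs_lt_one_iff, abs_lt]
    have hi' : (i : ℤ) < k + 3 := by exact_mod_cast hi
    have hj' : (j : ℤ) < k + 3 := by exact_mod_cast hj
    push_cast at h
    constructor
    · by_contra! hc
      nlinarith
    · by_contra! hc
      nlinarith
  subst hz0
  ext
  omega

theorem exists_cast_add_one (i : Fin (k + 3)) :
    ∃ z : ℤ, (i : ℝ) + 1 = ((i + 1 : Fin (k + 3)) : ℕ) + z * (k + 3 : ℕ) := by
  rcases Nat.lt_or_ge (i + 1) (k + 3) with h | h
  · refine ⟨0, ?_⟩
    have : ((i + 1 : Fin (k + 3)) : ℕ) = i + 1 := Fin.val_add_one_of_lt' h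
    rw [this]; push_cast; ring
  · refine ⟨1, ?_⟩
    have h' : (i : ℕ) = k + 2 := by omega
    have : i = Fin.last (k + 2) := Fin.ext h'
    rw [this]; simp; ring

/-- The bends of the arcs which represent edges of `G⁶₉₂`. -/
def g692Bend : Fin 8 → ℝ := ![0, 0, 0, 0, 0, 1, 1, -1]

def g692Height : Fin 8 → ℝ := ![1, 1, 1, 1, 1, 2, 2, 2]

theorem g692Height_eq (x : Fin 8) :
    ((g692Ends x).2 : ℝ) = (g692Ends x).1 + g692Height x := by
  fin_cases x <;> norm_num [g692Ends, g692Height]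

theorem g692Height_pos (x : Fin 8) : 0 < g692Height x := by
  fin_cases x <;> norm_num [g692Height]

theorem abs_g692Bend_le (x : Fin 8) : |g692Bend x| ≤ 1 := by
  fin_cases x <;> norm_num [g692Bend]

/-- An arc in the plane which represents an edge before rolling up. -/
noncomputable def flatArc : PrismEdge (Fin 8) (Fin 6) (k + 3) → ℝ → ℝ × ℝ
  | (.inl x, i), t => (i + g692Bend x * (t * (1 - t)), (g692Ends x).1 + g692Height x * t)
  | (.inr a, i), t => (i + t, a)

noncomputable def flatVertex (w : Fin 6 × Fin (k + 3)) : ℝ × ℝ := (w.2, w.1)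

theorem continuous_flatArc (p : PrismEdge (Fin 8) (Fin 6) (k + 3)) : Continuous (flatArc p) := by
  rcases p with ⟨x | a, i⟩ <;> unfold flatArc <;> fun_prop

theorem continuous_rollUp (c : ℝ) : Continuous (rollUp c) := by
  unfold rollUp; fun_prop

theorem natCast_add_three_ne_zero : ((k + 3 : ℕ) : ℝ) ≠ 0 := by positivity

theorem rollUp_flatVertex_injective :
    Function.Injective fun w : Fin 6 × Fin (k + 3) => rollUp (k + 3 : ℕ) (flatVertex w) := by
  rintro ⟨a, i⟩ ⟨b, j⟩ h
  obtain ⟨h1, z, h2⟩ := (rollUp_eq_iff natCast_add_three_ne_zero).mp h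
  simp only [flatVertex] at h1 h2
  have h3 := (eq_of_add_eq_add_mul (x := 0) (y := 0) (i := i) (j := j) (z := z) (by simp)
    (by simpa using h2)).1
  rw [h3, Fin.ext (Nat.cast_injective h1)]

theorem injOn_rollUp_flatArc (p : PrismEdge (Fin 8) (Fin 6) (k + 3)) :
    InjOn (fun t => rollUp (k + 3 : ℕ) (flatArc p t)) (Icc 0 1) := by
  intro s hs t ht h
  obtain ⟨h1, z, h2⟩ := (rollUp_eq_iff natCast_add_three_ne_zero).mp h
  rcases p with ⟨x | a, i⟩
  · simp only [flatArc] at h1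
    exact mul_left_cancel₀ (g692Height_pos x).ne' (add_left_cancel h1)
  · simp only [flatArc] at h2
    have hz : z = 0 := by
      rw [← Int.abs_lt_one_iff, abs_lt]
      have h3 : s - t = z * (k + 3 : ℕ) := by linarith
      have h4 : ((k + 3 : ℕ) : ℝ) = k + 3 := by push_cast; ring
      have h5 : (0 : ℝ) ≤ k := Nat.cast_nonneg k
      rw [h4] at h3
      constructor
      · have : (-1 : ℝ) < z := by
          by_contra! hc
          nlinarith [hs.1, hs.2, ht.1, ht.2]
        exact_mod_cast this
      · have : (z : ℝ) < 1 := by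
          by_contra! hc
          nlinarith [hs.1, hs.2, ht.1, ht.2]
        exact_mod_cast this
    rw [hz] at h2
    simpa using h2

theorem rollUp_flatArc_zero (p : PrismEdge (Fin 8) (Fin 6) (k + 3)) :
    rollUp (k + 3 : ℕ) (flatArc p 0) = rollUp (k + 3 : ℕ) (flatVertex (prismSrc g692Ends p)) := by
  rcases p with ⟨x | a, i⟩ <;> simp [flatArc, flatVertex, prismSrc]

theorem rollUp_flatArc_one (p : PrismEdge (Fin 8) (Fin 6) (k + 3)) :
    rollUp (k + 3 : ℕ) (flatArc p 1) = rollUp (k + 3 : ℕ) (flatVertex (prismTgt g692Ends p)) := by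
  rcases p with ⟨x | a, i⟩
  · simp [flatArc, flatVertex, prismTgt, g692Height_eq]
  · exact (rollUp_eq_iff natCast_add_three_ne_zero).mpr ⟨rfl, exists_cast_add_one i⟩

theorem mul_one_sub_mem {t : ℝ} (ht : t ∈ Ioo (0 : ℝ) 1) : t * (1 - t) ∈ Ioc (0 : ℝ) (1 / 4) :=
  ⟨mul_pos ht.1 (by linarith [ht.2]), by nlinarith [sq_nonneg (t - 1 / 2)]⟩

theorem abs_bend_mul_le (x : Fin 8) {t : ℝ} (ht : t ∈ Ioo (0 : ℝ) 1) :
    |g692Bend x * (t * (1 - t))| ≤ 1 / 4 := by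
  have h := mul_one_sub_mem ht
  rw [abs_mul, abs_of_pos h.1]
  nlinarith [abs_g692Bend_le x, h.1, h.2, abs_nonneg (g692Bend x)]

/-- If an arc which represents an edge of `G⁶₉₂` meets a level of vertices at an interior point,
then this point is the midpoint. -/
theorem exists_chord_of_height_eq {x : Fin 8} {a : Fin 6} {t : ℝ} (ht : t ∈ Ioo (0 : ℝ) 1)
    (h : ((g692Ends x).1 : ℝ) + g692Height x * t = a) :
    t = 1 / 2 ∧ ((g692Bend x = 1 ∧ (x = 5 ∧ a = 1 ∨ x = 6 ∧ a = 3)) ∨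
      (g692Bend x = -1 ∧ x = 7 ∧ a = 4)) := by
  obtain ⟨h0, h1⟩ := ht
  fin_cases x <;> fin_cases a <;> norm_num [g692Ends, g692Height] at h <;>
    first
    | exfalso; linarith
    | exact ⟨by linarith, by simp [g692Bend]⟩

theorem rollUp_flatArc_ne (p : PrismEdge (Fin 8) (Fin 6) (k + 3)) {t : ℝ}
    (ht : t ∈ Ioo (0 : ℝ) 1) (w : Fin 6 × Fin (k + 3)) :
    rollUp (k + 3 : ℕ) (flatArc p t) ≠ rollUp (k + 3 : ℕ) (flatVertex w) := by
  intro h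
  obtain ⟨h1, z, h2⟩ := (rollUp_eq_iff natCast_add_three_ne_zero).mp h
  rcases p with ⟨x | a, i⟩
  · simp only [flatArc, flatVertex] at h1 h2
    have h3 := (eq_of_add_eq_add_mul (y := 0) (i := i) (j := w.2) (z := z) (by
      rw [sub_zero]; linarith [abs_bend_mul_le x ht]) (by rw [add_zero]; exact h2)).2
    have hpos := (mul_one_sub_mem ht).1
    rcases (exists_chord_of_height_eq ht h1).2 with ⟨hb, -⟩ | ⟨hb, -⟩ <;> rw [hb] at h3 <;>
      linarith
  · simp only [flatArc, flatVertex] at h2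
    have h3 := (eq_of_add_eq_add_mul (x := t) (y := 0) (i := i) (j := w.2) (z := z) (by
      rw [sub_zero, abs_lt]; constructor <;> linarith [ht.1, ht.2])
      (by rw [add_zero]; exact h2)).2
    linarith [ht.1]

/-- The drawing of the product of `G⁶₉₂` and a cycle. -/
noncomputable def g692Drawing (k : ℕ) : Drawing (G6_92 □ SimpleGraph.cycleGraph (k + 3)) where
  vertexMap w := rollUp (k + 3 : ℕ) (flatVertex w)
  vertexMap_injective := rollUp_flatVertex_injective
  arc e t := rollUp (k + 3 : ℕ) (flatArc (Function.surjInv g692Edge_surjective e) t)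
  arc_continuousOn e := ((continuous_rollUp _).comp (continuous_flatArc _)).continuousOn
  arc_injOn e := injOn_rollUp_flatArc _
  arc_endpoints e := by
    refine ⟨_, _, ?_, rollUp_flatArc_zero _, rollUp_flatArc_one _⟩
    rw [← g692Edge_coe, Function.surjInv_eq g692Edge_surjective e]
  arc_avoids_vertices e t ht w := rollUp_flatArc_ne _ ht w

theorem g692Drawing_arc (p : PrismEdge (Fin 8) (Fin 6) (k + 3)) (t : ℝ) :
    (g692Drawing k).arc (g692Edge p) t = rollUp (k + 3 : ℕ) (flatArc p t) := by
  change rollUp _ (flatArc (Function.surjInv g692Edge_surjective (g692Edge p)) t) = _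
  rw [g692Edge_injective (Function.surjInv_eq g692Edge_surjective (g692Edge p))]

noncomputable def g692Crossing (y : Fin 3 × Fin (k + 3)) :
    Sym2 (G6_92 □ SimpleGraph.cycleGraph (k + 3)).edgeSet × (ℝ × ℝ) :=
  let chord : PrismEdge (Fin 8) (Fin 6) (k + 3) := (.inl (![5, 6, 7] y.1), y.2)
  (s(g692Edge chord, g692Edge (.inr (![1, 3, 4] y.1), ![y.2, y.2, y.2 - 1] y.1)),
    rollUp (k + 3 : ℕ) (flatArc chord (1 / 2)))

theorem exists_g692Crossing_of_inl_inr {x : Fin 8} {a : Fin 6} {i j : Fin (k + 3)} {s t : ℝ}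
    (hs : s ∈ Ioo (0 : ℝ) 1) (ht : t ∈ Ioo (0 : ℝ) 1)
    (h : rollUp (k + 3 : ℕ) (flatArc (.inl x, i) s) = rollUp (k + 3 : ℕ) (flatArc (.inr a, j) t)) :
    ∃ y, g692Crossing y = (s(g692Edge (.inl x, i), g692Edge (.inr a, j)),
      rollUp (k + 3 : ℕ) (flatArc (.inl x, i) s)) := by
  obtain ⟨h1, z, h2⟩ := (rollUp_eq_iff natCast_add_three_ne_zero).mp h
  simp only [flatArc] at h1 h2
  obtain ⟨rfl, hx⟩ := exists_chord_of_height_eq hs h1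
  rcases hx with ⟨hb, hx⟩ | ⟨hb, hx⟩
  · rw [hb] at h2
    obtain ⟨rfl, -⟩ := eq_of_add_eq_add_mul
      (by rw [abs_lt]; constructor <;> linarith [ht.1, ht.2]) h2
    rcases hx with ⟨rfl, rfl⟩ | ⟨rfl, rfl⟩
    · exact ⟨(0, i), rfl⟩
    · exact ⟨(1, i), rfl⟩
  · rw [hb] at h2
    obtain ⟨z', hz'⟩ := exists_cast_add_one j
    obtain ⟨hij, -⟩ := eq_of_add_eq_add_mul (i := i) (j := j + 1) (x := -1 * (1 / 2 * (1 - 1 / 2)))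
      (y := t - 1) (z := z + z') (by rw [abs_lt]; constructor <;> linarith [ht.1, ht.2]) (by
        push_cast at h2 hz' ⊢
        linarith)
    obtain rfl := eq_sub_of_add_eq hij.symm
    obtain ⟨rfl, rfl⟩ := hx
    exact ⟨(2, i), rfl⟩

theorem eq_of_inl_inl {x y : Fin 8} {i j : Fin (k + 3)} {s t : ℝ}
    (hs : s ∈ Ioo (0 : ℝ) 1) (ht : t ∈ Ioo (0 : ℝ) 1)
    (h : rollUp (k + 3 : ℕ) (flatArc (.inl x, i) s) = rollUp (k + 3 : ℕ) (flatArc (.inl y, j) t)) :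
    x = y ∧ i = j := by
  obtain ⟨h1, z, h2⟩ := (rollUp_eq_iff natCast_add_three_ne_zero).mp h
  simp only [flatArc] at h1 h2
  obtain ⟨rfl, h3⟩ := eq_of_add_eq_add_mul (by
    refine (abs_sub _ _).trans_lt ?_
    linarith [abs_bend_mul_le x hs, abs_bend_mul_le y ht]) h2
  refine ⟨?_, rfl⟩
  have hs' := (mul_one_sub_mem hs).1
  have ht' := (mul_one_sub_mem ht).1
  obtain ⟨hs0, hs1⟩ := hs
  obtain ⟨ht0, ht1⟩ := ht
  generalize s * (1 - s) = u at h3 hs'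
  generalize t * (1 - t) = w at h3 ht'
  clear h h2
  fin_cases x <;> fin_cases y <;>
    first
    | rfl
    | exfalso; norm_num [g692Ends, g692Height, g692Bend] at h1 h3; linarith

theorem eq_of_inr_inr {a b : Fin 6} {i j : Fin (k + 3)} {s t : ℝ}
    (hs : s ∈ Ioo (0 : ℝ) 1) (ht : t ∈ Ioo (0 : ℝ) 1)
    (h : rollUp (k + 3 : ℕ) (flatArc (.inr a, i) s) = rollUp (k + 3 : ℕ) (flatArc (.inr b, j) t)) :
    a = b ∧ i = j := by
  obtain ⟨h1, z, h2⟩ := (rollUp_eq_iff natCast_add_three_ne_zero).mp h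
  simp only [flatArc] at h1 h2
  exact ⟨Fin.ext (Nat.cast_injective h1), (eq_of_add_eq_add_mul
    (by rw [abs_lt]; constructor <;> linarith [hs.1, hs.2, ht.1, ht.2]) h2).1⟩

theorem g692Drawing_crossings_subset :
    (g692Drawing k).crossings ⊆ range (g692Crossing (k := k)) := by
  rintro ⟨ef, pt⟩ ⟨e, f, hne, rfl, ⟨s, hs, hse⟩, t, ht, htf⟩
  obtain ⟨⟨p, i⟩, rfl⟩ := g692Edge_surjective e
  obtain ⟨⟨q, j⟩, rfl⟩ := g692Edge_surjective f
  simp only [g692Drawing_arc] at hse htf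
  subst hse
  rcases p with x | a <;> rcases q with y | b
  · obtain ⟨rfl, rfl⟩ := eq_of_inl_inl hs ht htf.symm
    exact absurd rfl hne
  · exact exists_g692Crossing_of_inl_inr hs ht htf.symm
  · obtain ⟨w, hw⟩ := exists_g692Crossing_of_inl_inr ht hs htf
    exact ⟨w, by rw [hw, htf, Sym2.eq_swap]⟩
  · obtain ⟨rfl, rfl⟩ := eq_of_inr_inr hs ht htf.symm
    exact absurd rfl hne

theorem g692Drawing_finite_crossings : (g692Drawing k).crossings.Finite :=
  (finite_range _).subset g692Drawing_crossings_subset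

theorem ncard_g692Drawing_crossings_le : (g692Drawing k).crossings.ncard ≤ 3 * (k + 3) := by
  refine (ncard_le_ncard g692Drawing_crossings_subset (finite_range _)).trans ?_
  rw [← image_univ]
  refine (ncard_image_le (finite_univ)).trans ?_
  simp [ncard_univ]

end UpperBound

/-- The crossing number of `G⁶₉₂ □ Cₙ` is `3n` for all `n ≥ 4`. -/
theorem crossingNumber_G6_92_boxProd_cycle (n : ℕ) (hn : 4 ≤ n) :
    crossingNumber (G6_92 □ SimpleGraph.cycleGraph n) = 3 * n := by
  obtain ⟨k, rfl⟩ : ∃ k, n = k + 3 := ⟨n - 3, by omega⟩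
  have hmem : 3 * (k + 3) ∈ {m : ℕ | ∃ D : Drawing (G6_92 □ SimpleGraph.cycleGraph (k + 3)),
      D.crossings.Finite ∧ D.crossings.ncard = m} :=
    ⟨g692Drawing k, g692Drawing_finite_crossings, le_antisymm ncard_g692Drawing_crossings_le
      (three_mul_le_ncard_crossings _ g692Drawing_finite_crossings)⟩
  refine le_antisymm (Nat.sInf_le hmem) (le_csInf ⟨_, hmem⟩ ?_)
  rintro m ⟨D, hD, rfl⟩
  exact three_mul_le_ncard_crossings D hD
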